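/- arXiv:0809.3132 — 2 statements merged into one kernel-verified Lean document; each statement's English description precedes it below -/
import Mathlib

section
/- Let N be a free ℤ-module of finite rank n and let M be a submodule of N of rank n (equivalently, of finite index). Then the group homomorphism ξ_M : T_M → T_N induced by the inclusion M ↪ N is surjective, and its kernel is a finite abelian group isomorphic to the quotient N/M. -/
open scoped TensorProduct

noncomputable section

/-- The lattice embedding `A → ℝ ⊗ A`, `a ↦ 1 ⊗ a`, identifying `A` with `A ⊗ 1`. -/
def latticeEmb (A : Type*) [AddCommGroup A] : A →+ ℝ ⊗[ℤ] A where
  toFun a := (1 : ℝ) ⊗ₜ[ℤ] a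
  map_zero' := TensorProduct.tmul_zero _ _
  map_add' a b := TensorProduct.tmul_add _ a b

/-- The torus `T_A = (A ⊗ ℝ)/A`. -/
abbrev TorusOf (A : Type*) [AddCommGroup A] : Type _ :=
  (ℝ ⊗[ℤ] A) ⧸ (latticeEmb A).range

/-- The group homomorphism `T_A → T_B` induced by a `ℤ`-linear map `A → B`. -/
def torusHom {A B : Type*} [AddCommGroup A] [AddCommGroup B] (f : A →ₗ[ℤ] B) :
    TorusOf A →+ TorusOf B :=
  QuotientAddGroup.map _ _ (LinearMap.lTensor ℝ f).toAddMonoidHom (by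
    rintro x ⟨a, rfl⟩
    exact ⟨f a, by simp [latticeEmb]⟩)

lemma latticeEmb_injective (A : Type*) [AddCommGroup A] [Module.Flat ℤ A] :
    Function.Injective (latticeEmb A) := by
  have h := Module.Flat.rTensor_preserves_injective_linearMap (M := A)
    (Algebra.linearMap ℤ ℝ) (RingHom.injective_int (algebraMap ℤ ℝ))
  intro a b hab
  refine (TensorProduct.lid ℤ A).symm.injective (h ?_)
  simpa [latticeEmb] using hab

lemma lTensor_real_surjective {A B : Type*} [AddCommGroup A] [AddCommGroup B]
    (f : A →ₗ[ℤ] B) {k : ℤ} (hk : k ≠ 0) (hf : ∀ b, k • b ∈ LinearMap.range f) :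
    Function.Surjective (LinearMap.lTensor ℝ f) := by
  intro x
  induction x using TensorProduct.induction_on with
  | zero => exact ⟨0, map_zero _⟩
  | tmul r b =>
    obtain ⟨a, ha⟩ := hf b
    refine ⟨(r / k) ⊗ₜ a, ?_⟩
    have hk' : (k : ℝ) ≠ 0 := Int.cast_ne_zero.mpr hk
    rw [LinearMap.lTensor_tmul, ha, ← TensorProduct.smul_tmul, zsmul_eq_mul,
      mul_div_cancel₀ r hk']
  | add x y hx hy =>
    obtain ⟨u, rfl⟩ := hx
    obtain ⟨v, rfl⟩ := hy
    exact ⟨u + v, map_add _ _ _⟩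

lemma torusHom_surjective {A B : Type*} [AddCommGroup A] [AddCommGroup B] {f : A →ₗ[ℤ] B}
    (hf : Function.Surjective (LinearMap.lTensor ℝ f)) : Function.Surjective (torusHom f) :=
  QuotientAddGroup.map_surjective_of_surjective _ _ _
    ((QuotientAddGroup.mk'_surjective _).comp hf) _

/-- If `f` becomes bijective over `ℝ`, then `ker (torusHom f)` is the cokernel of `f`. -/
lemma nonempty_ker_torusHom_equiv {A B C : Type*} [AddCommGroup A] [AddCommGroup B]
    [AddCommGroup C] [Module.Flat ℤ B] {f : A →ₗ[ℤ] B}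
    (hf : Function.Bijective (LinearMap.lTensor ℝ f)) (π : B →+ C)
    (hπ : Function.Surjective π) (hker : π.ker = f.toAddMonoidHom.range) :
    Nonempty ((torusHom f).ker ≃+ C) := by
  let e := LinearEquiv.ofBijective _ hf
  have he (a : A) : e (latticeEmb A a) = latticeEmb B (f a) := LinearMap.lTensor_tmul _ _ _ _
  let φ : B →+ TorusOf A :=
    (QuotientAddGroup.mk' _).comp (e.symm.toLinearMap.toAddMonoidHom.comp (latticeEmb B))
  have hφ (b : B) : φ b = QuotientAddGroup.mk (e.symm (latticeEmb B b)) := rfl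
  have htorus (x : ℝ ⊗[ℤ] A) : torusHom f (QuotientAddGroup.mk x) = QuotientAddGroup.mk (e x) :=
    rfl
  have hmem (b : B) : φ b ∈ (torusHom f).ker := by
    rw [AddMonoidHom.mem_ker, hφ, htorus, e.apply_symm_apply, QuotientAddGroup.eq_zero_iff]
    exact ⟨b, rfl⟩
  have hψ : Function.Surjective (φ.codRestrict _ hmem) := by
    rintro ⟨t, ht⟩
    obtain ⟨x, rfl⟩ := QuotientAddGroup.mk_surjective t
    rw [AddMonoidHom.mem_ker, htorus, QuotientAddGroup.eq_zero_iff] at ht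
    obtain ⟨b, hb⟩ := ht
    exact ⟨b, Subtype.ext ((hφ b).trans (by rw [hb, e.symm_apply_apply]))⟩
  have hkerψ : (φ.codRestrict _ hmem).ker = π.ker := by
    rw [hker, AddMonoidHom.ker_codRestrict]
    ext b
    rw [AddMonoidHom.mem_ker, hφ, QuotientAddGroup.eq_zero_iff]
    refine exists_congr fun a ↦ ?_
    rw [e.eq_symm_apply, he]
    exact (latticeEmb_injective B).eq_iff
  exact ⟨(QuotientAddGroup.quotientKerEquivOfSurjective _ hψ).symm.trans <|
    (QuotientAddGroup.quotientAddEquivOfEq hkerψ).trans <|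
      QuotientAddGroup.quotientKerEquivOfSurjective π hπ⟩

/-- for a full-rank submodule `M` of a finite-rank free `ℤ`-module `N`, the
induced map `ξ_M : T_M → T_N` is surjective and its kernel is a finite abelian group
isomorphic to `N/M`. -/
theorem torusHom_subtype_surjective_and_ker_finite_equiv_quotient
    (N : Type*) [AddCommGroup N] [Module ℤ N] [Module.Free ℤ N] [Module.Finite ℤ N]
    (M : Submodule ℤ N)
    (hrank : Module.finrank ℤ M = Module.finrank ℤ N) :
    Function.Surjective (torusHom (A := M) (B := N) M.subtype) ∧
      Finite (torusHom (A := M) (B := N) M.subtype).ker ∧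
      Nonempty ((torusHom (A := M) (B := N) M.subtype).ker ≃+ N ⧸ M) := by
  obtain rfl : ‹Module ℤ N› = AddCommGroup.toIntModule N := Subsingleton.elim _ _
  have hfin : Finite (N ⧸ M) := Submodule.finiteQuotientOfFreeOfRankEq M hrank
  have hbij : Function.Bijective (LinearMap.lTensor ℝ (M.subtype.restrictScalars ℤ)) := by
    refine ⟨Module.Flat.lTensor_preserves_injective_linearMap _ M.injective_subtype,
      lTensor_real_surjective _ (k := Nat.card (N ⧸ M))
        (Nat.cast_ne_zero.mpr Nat.card_pos.ne') fun b ↦ ?_⟩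
    have hb : (Nat.card (N ⧸ M) : ℤ) • b ∈ M := by
      rw [← Submodule.Quotient.mk_eq_zero, Submodule.Quotient.mk_smul, natCast_zsmul]
      exact card_nsmul_eq_zero'
    exact ⟨⟨_, hb⟩, rfl⟩
  obtain ⟨E⟩ := nonempty_ker_torusHom_equiv hbij M.mkQ.toAddMonoidHom M.mkQ_surjective (by
    ext b
    simp)
  exact ⟨torusHom_surjective hbij.2, Finite.of_equiv _ E.symm.toEquiv, ⟨E⟩⟩
end
end

section
/- Let n ≥ 1 and let G be a finite group acting on ℝⁿ by orientation-preserving orthogonal linear transformations (i.e., G is a finite subgroup of O(n) all of whose elements have determinant 1). Then the orbit space S^{n-1}/G of the unit sphere is a rational homology sphere: for every p, the singular homology H_p(S^{n-1}/G; ℚ) is isomorphic to H_p(S^{n-1}; ℚ). -/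
open CategoryTheory

noncomputable section

/-- The singular chain complex of a topological space with rational coefficients:
the alternating face map complex of the free simplicial `ℚ`-module on the singular
simplicial set. -/
def singularChainComplexQ (X : TopCat) : ChainComplex (ModuleCat ℚ) ℕ :=
  (AlgebraicTopology.alternatingFaceMapComplex (ModuleCat ℚ)).obj
    (((SimplicialObject.whiskering _ _).obj (ModuleCat.free ℚ)).obj (TopCat.toSSet.obj X))

/-- The `p`-th singular homology of a topological space, with rational coefficients. -/
def singularHomologyQ (X : TopCat) (p : ℕ) : ModuleCat ℚ :=
  (singularChainComplexQ X).homology p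

/-- The orbit equivalence relation on the unit sphere `S^{n-1} ⊆ ℝⁿ` for the action of a
subgroup `G` of the group of linear isometries of `ℝⁿ`. -/
def sphereOrbitSetoid (n : ℕ)
    (G : Subgroup (EuclideanSpace ℝ (Fin n) ≃ₗᵢ[ℝ] EuclideanSpace ℝ (Fin n))) :
    Setoid (Metric.sphere (0 : EuclideanSpace ℝ (Fin n)) 1) where
  r x y := ∃ g ∈ G, g x.1 = y.1
  iseqv := by
    constructor
    · intro x
      exact ⟨1, G.one_mem, by simp [LinearIsometryEquiv.coe_one]⟩
    · rintro x y ⟨g, hg, h⟩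
      exact ⟨g⁻¹, G.inv_mem hg, by
        rw [← h, LinearIsometryEquiv.coe_inv]
        exact g.symm_apply_apply x.1⟩
    · rintro x y z ⟨g, hg, hxy⟩ ⟨h, hh, hyz⟩
      exact ⟨h * g, G.mul_mem hh hg, by
        rw [← hyz, ← hxy, LinearIsometryEquiv.coe_mul]
        rfl⟩

namespace RatChain

open Finsupp

section Alternating

variable {S T : ℕ → Type} (δ : ∀ p, Fin (p + 2) → S (p + 1) → S p)
  (ε : ∀ p, Fin (p + 2) → T (p + 1) → T p)

/-- The alternating sum of the faces, on the free `ℚ`-modules over a graded set with faces. -/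
def altBd (p : ℕ) : (S (p + 1) →₀ ℚ) →ₗ[ℚ] (S p →₀ ℚ) :=
  linearCombination ℚ fun s ↦ ∑ i : Fin (p + 2), single (δ p i s) ((-1 : ℚ) ^ (i : ℕ))

lemma altBd_single (p : ℕ) (s : S (p + 1)) (c : ℚ) :
    altBd δ p (single s c) = c • ∑ i : Fin (p + 2), single (δ p i s) ((-1 : ℚ) ^ (i : ℕ)) := by
  simp [altBd]

lemma altBd_altBd
    (h : ∀ p (i j : Fin (p + 2)), i ≤ j → ∀ s, δ p i (δ (p + 1) j.succ s) =
      δ p j (δ (p + 1) i.castSucc s)) (p : ℕ) (z : S (p + 2) →₀ ℚ) :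
    altBd δ p (altBd δ (p + 1) z) = 0 := by
  suffices altBd δ p ∘ₗ altBd δ (p + 1) = 0 from LinearMap.congr_fun this z
  ext1 s
  ext1
  simp only [LinearMap.comp_apply, lsingle_apply, altBd_single, one_smul, map_sum,
    LinearMap.zero_apply]
  simp only [Finset.smul_sum, smul_single, smul_eq_mul]
  rw [← Finset.sum_product', Finset.univ_product_univ]
  let Q : Finset (Fin (p + 3) × Fin (p + 2)) := {ij | (ij.1 : ℕ) ≤ (ij.2 : ℕ)}
  rw [← Finset.sum_add_sum_compl Q, ← eq_neg_iff_add_eq_zero, ← Finset.sum_neg_distrib]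
  refine Finset.sum_bij' (fun ij _ ↦ (ij.2.succ, ⟨min ij.1 (p + 1), by omega⟩))
    (fun ij _ ↦ (ij.2.castSucc, ⟨ij.1 - 1, by omega⟩)) ?_ ?_ ?_ ?_ ?_
  · rintro ⟨i, j⟩ hij
    simp [Q] at hij ⊢
    omega
  · rintro ⟨i, j⟩ hij
    simp [Q] at hij ⊢
    omega
  · rintro ⟨i, j⟩ hij
    simp [Q] at hij
    ext <;> simp
    omega
  · rintro ⟨i, j⟩ hij
    simp [Q] at hij
    ext <;> simp <;> omega
  · rintro ⟨i, j⟩ hij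
    simp only [Q, Finset.mem_filter, Finset.mem_univ, true_and] at hij
    obtain ⟨i', rfl⟩ : ∃ i' : Fin (p + 2), i = i'.castSucc :=
      ⟨⟨i, by omega⟩, rfl⟩
    have e : (⟨min (i'.castSucc : ℕ) (p + 1), by omega⟩ : Fin (p + 2)) = i' := by
      ext; simp; omega
    simp only [e]
    rw [h p i' j hij, ← single_neg]
    congr 1
    have e' : min (i' : ℕ) (p + 1) = i' := by omega
    simp only [Fin.val_castSucc, Fin.val_succ, e', pow_succ]
    ring

lemma altBd_lmapDomain (f : ∀ p, S p → T p)
    (h : ∀ p i s, f p (δ p i s) = ε p i (f (p + 1) s)) (p : ℕ) (z : S (p + 1) →₀ ℚ) :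
    altBd ε p (lmapDomain ℚ ℚ (f (p + 1)) z) = lmapDomain ℚ ℚ (f p) (altBd δ p z) := by
  suffices altBd ε p ∘ₗ lmapDomain ℚ ℚ (f (p + 1)) = lmapDomain ℚ ℚ (f p) ∘ₗ altBd δ p from
    LinearMap.congr_fun this z
  ext1 s
  ext1
  simp [altBd_single, mapDomain_single, h]

end Alternating

lemma succAbove_comp_succAbove {p : ℕ} (i j : Fin (p + 2)) (h : i ≤ j) :
    j.succ.succAbove ∘ i.succAbove = i.castSucc.succAbove ∘ j.succAbove := by
  funext k
  have := ConcreteCategory.congr_hom (SimplexCategory.δ_comp_δ h) k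
  exact this

variable {X Y Z : Type} [TopologicalSpace X] [TopologicalSpace Y] [TopologicalSpace Z]

/-- The singular `p`-simplices of a space. -/
abbrev Simplex (p : ℕ) (X : Type) [TopologicalSpace X] : Type :=
  C(stdSimplex ℝ (Fin (p + 1)), X)

/-- The rational singular `p`-chains of a space. -/
abbrev Chain (p : ℕ) (X : Type) [TopologicalSpace X] : Type := Simplex p X →₀ ℚ

/-- The map of standard simplices induced by a map of vertices. -/
def stdMap {p q : ℕ} (f : Fin (p + 1) → Fin (q + 1)) :
    C(stdSimplex ℝ (Fin (p + 1)), stdSimplex ℝ (Fin (q + 1))) :=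
  ⟨stdSimplex.map f, stdSimplex.continuous_map f⟩

lemma stdMap_comp {p q r : ℕ} (g : Fin (q + 1) → Fin (r + 1)) (f : Fin (p + 1) → Fin (q + 1)) :
    (stdMap g).comp (stdMap f) = stdMap (g ∘ f) := by
  ext1 x
  exact stdSimplex.map_comp_apply f g x

/-- The `i`-th face of a singular simplex. -/
def face (p : ℕ) (i : Fin (p + 2)) (σ : Simplex (p + 1) X) : Simplex p X :=
  σ.comp (stdMap i.succAbove)

lemma range_face_subset (p : ℕ) (i : Fin (p + 2)) (σ : Simplex (p + 1) X) :
    Set.range (face p i σ) ⊆ Set.range σ := by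
  rintro _ ⟨x, rfl⟩
  exact ⟨_, rfl⟩

/-- The boundary operator on singular chains. -/
def bd {p : ℕ} : Chain (p + 1) X →ₗ[ℚ] Chain p X :=
  altBd (S := fun p ↦ Simplex p X) face p

lemma bd_single {p : ℕ} (σ : Simplex (p + 1) X) (c : ℚ) :
    bd (single σ c) = c • ∑ i : Fin (p + 2), single (face p i σ) ((-1 : ℚ) ^ (i : ℕ)) :=
  altBd_single (S := fun p ↦ Simplex p X) face p σ c

lemma bd_bd {p : ℕ} (z : Chain (p + 2) X) : bd (bd z) = 0 := by
  refine altBd_altBd (S := fun p ↦ Simplex p X) face (fun p i j h σ ↦ ?_) p z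
  simp only [face, ContinuousMap.comp_assoc, stdMap_comp, succAbove_comp_succAbove i j h]

/-- The map induced on chains by a continuous map. -/
def push {p : ℕ} (f : C(X, Y)) : Chain p X →ₗ[ℚ] Chain p Y :=
  lmapDomain ℚ ℚ fun σ ↦ f.comp σ

@[simp]
lemma push_single {p : ℕ} (f : C(X, Y)) (σ : Simplex p X) (c : ℚ) :
    push f (single σ c) = single (f.comp σ) c := by
  simp [push]

lemma bd_push {p : ℕ} (f : C(X, Y)) (z : Chain (p + 1) X) : bd (push f z) = push f (bd z) :=
  altBd_lmapDomain (S := fun p ↦ Simplex p X) (T := fun p ↦ Simplex p Y) face face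
    (fun _ σ ↦ f.comp σ) (fun _ _ _ ↦ rfl) p z

lemma push_push {p : ℕ} (g : C(Y, Z)) (f : C(X, Y)) (z : Chain p X) :
    push g (push f z) = push (g.comp f) z := by
  simp only [push, lmapDomain_apply, ← mapDomain_comp]
  rfl

@[simp]
lemma push_id {p : ℕ} (z : Chain p X) : push (ContinuousMap.id X) z = z := by
  simp only [push, lmapDomain_apply]
  exact mapDomain_id

/-- The chains whose simplices have their image in a given subset. -/
def within (p : ℕ) (A : Set X) : Submodule ℚ (Chain p X) :=
  supported ℚ ℚ {σ : Simplex p X | Set.range σ ⊆ A}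

lemma single_mem_within {p : ℕ} {A : Set X} {σ : Simplex p X} (h : Set.range σ ⊆ A) (c : ℚ) :
    single σ c ∈ within p A :=
  single_mem_supported ℚ c h

lemma within_mono {p : ℕ} {A B : Set X} (h : A ⊆ B) : within p A ≤ within p B :=
  supported_mono fun _ hσ ↦ hσ.trans h

/-- A linear map out of a module of finitely supported functions sends the functions supported
in `s` into a submodule as soon as it does so on generators. -/
lemma map_mem_of_supported {α M : Type} [AddCommGroup M] [Module ℚ M] {s : Set α}
    {N : Submodule ℚ M} (f : (α →₀ ℚ) →ₗ[ℚ] M) (h : ∀ a ∈ s, f (single a 1) ∈ N)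
    {z : α →₀ ℚ} (hz : z ∈ supported ℚ ℚ s) : f z ∈ N := by
  rw [supported_eq_span_single] at hz
  refine (Submodule.span_le (p := N.comap f)).2 ?_ hz
  rintro _ ⟨a, ha, rfl⟩
  exact h a ha

lemma eqOn_supported {α M : Type} [AddCommGroup M] [Module ℚ M] {s : Set α}
    (f g : (α →₀ ℚ) →ₗ[ℚ] M) (h : ∀ a ∈ s, f (single a 1) = g (single a 1))
    {z : α →₀ ℚ} (hz : z ∈ supported ℚ ℚ s) : f z = g z := by
  have := map_mem_of_supported (N := ⊥) (f - g) (s := s) (by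
    intro a ha
    simp [h a ha]) hz
  simpa [sub_eq_zero] using this

lemma bd_single_mem {p : ℕ} {N : Submodule ℚ (Chain p X)} (σ : Simplex (p + 1) X)
    (h : ∀ i, single (face p i σ) 1 ∈ N) (c : ℚ) : bd (single σ c) ∈ N := by
  rw [bd_single]
  refine N.smul_mem _ (N.sum_mem fun i _ ↦ ?_)
  have := N.smul_mem ((-1 : ℚ) ^ (i : ℕ)) (h i)
  simpa using this

lemma bd_mem_within {p : ℕ} {A : Set X} {z : Chain (p + 1) X} (hz : z ∈ within (p + 1) A) :
    bd z ∈ within p A :=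
  map_mem_of_supported _ (fun σ hσ ↦ bd_single_mem σ
    (fun i ↦ single_mem_within ((range_face_subset p i σ).trans hσ) _) _) hz

lemma push_mem_within {p : ℕ} {A : Set X} {B : Set Y} {f : C(X, Y)} (hf : Set.MapsTo f A B)
    {z : Chain p X} (hz : z ∈ within p A) : push f z ∈ within p B := by
  refine map_mem_of_supported _ (fun σ hσ ↦ ?_) hz
  rw [push_single]
  refine single_mem_within ?_ _
  rintro _ ⟨x, rfl⟩
  exact hf (hσ ⟨x, rfl⟩)

/-- Every chain within `A` comes from the subspace `A`. -/
lemma exists_push_subtype {p : ℕ} {A : Set X} {z : Chain p X} (hz : z ∈ within p A) :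
    ∃ y : Chain p A, push ⟨Subtype.val, continuous_subtype_val⟩ y = z := by
  refine map_mem_of_supported (N := LinearMap.range (push (p := p)
    (⟨Subtype.val, continuous_subtype_val⟩ : C(A, X)))) LinearMap.id (fun σ hσ ↦ ?_) hz
  refine ⟨single ⟨fun t ↦ ⟨σ t, hσ ⟨t, rfl⟩⟩, by fun_prop⟩ 1, ?_⟩
  rw [push_single]
  rfl

lemma push_injective {p : ℕ} {f : C(X, Y)} (hf : Function.Injective f) :
    Function.Injective (push (p := p) f) :=
  mapDomain_injective fun _ _ h ↦ ContinuousMap.ext fun t ↦ hf (ContinuousMap.congr_fun h t)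

lemma push_subtype_mem_within {p : ℕ} {A : Set X} (y : Chain p A) :
    push (⟨Subtype.val, continuous_subtype_val⟩ : C(A, X)) y ∈ within p A := by
  refine push_mem_within (A := Set.univ) (fun x _ ↦ x.2) ?_
  simp [within]

/-- A chain is a cycle if its boundary vanishes; in degree `0` there is no condition. -/
def IsCycle : ∀ {p : ℕ}, Chain p X → Prop
  | 0, _ => True
  | _ + 1, z => bd z = 0

lemma IsCycle.push {p : ℕ} (f : C(X, Y)) {z : Chain p X} (hz : IsCycle z) :
    IsCycle (push f z) := by
  cases p with
  | zero => trivial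
  | succ p =>
    change bd _ = 0
    rw [bd_push, show bd z = 0 from hz, map_zero]

lemma isCycle_bd {p : ℕ} (z : Chain (p + 1) X) : IsCycle (bd z) := by
  cases p with
  | zero => trivial
  | succ p => exact bd_bd z

lemma IsCycle.add {p : ℕ} {z w : Chain p X} (hz : IsCycle z) (hw : IsCycle w) :
    IsCycle (z + w) := by
  cases p with
  | zero => trivial
  | succ p =>
    change bd _ = 0
    rw [map_add, show bd z = 0 from hz, show bd w = 0 from hw, add_zero]

lemma IsCycle.smul {p : ℕ} {z : Chain p X} (hz : IsCycle z) (c : ℚ) : IsCycle (c • z) := by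
  cases p with
  | zero => trivial
  | succ p =>
    change bd _ = 0
    rw [map_smul, show bd z = 0 from hz, smul_zero]

variable {X Y : Type} [TopologicalSpace X] [TopologicalSpace Y]

/-- Tuples of `p + 1` points of the standard `q`-simplex. -/
abbrev Tuple (q p : ℕ) : Type := Fin (p + 1) → stdSimplex ℝ (Fin (q + 1))

/-- The affine map of standard simplices with prescribed values at the vertices. -/
def affine {p q : ℕ} (v : Tuple q p) :
    C(stdSimplex ℝ (Fin (p + 1)), stdSimplex ℝ (Fin (q + 1))) where
  toFun t := ⟨∑ i, t i • (v i).1,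
    (convex_stdSimplex ℝ _).sum_mem (fun i _ ↦ t.2.1 i) t.2.2 fun i _ ↦ (v i).2⟩
  continuous_toFun := by
    refine Continuous.subtype_mk (continuous_finsetSum _ fun i _ ↦ ?_) _
    exact ((continuous_apply i).comp continuous_subtype_val).smul continuous_const

lemma coe_affine {p q : ℕ} (v : Tuple q p) (t : stdSimplex ℝ (Fin (p + 1))) :
    (affine v t).1 = ∑ i, t.1 i • (v i).1 := rfl

/-- The tuple of the vertices of the standard simplex. -/
def vertices (q : ℕ) : Tuple q q := fun i ↦ stdSimplex.vertex i

lemma affine_vertices (q : ℕ) : affine (vertices q) = ContinuousMap.id _ := by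
  ext1 t
  apply Subtype.ext
  rw [coe_affine]
  ext j
  simp [vertices, Pi.single_apply]

lemma affine_apply_vertices {p q : ℕ} (v : Tuple q p) : affine v ∘ vertices p = v := by
  funext i
  apply Subtype.ext
  simp [coe_affine, vertices, Pi.single_apply]

lemma affine_comp_affine {p q r : ℕ} (v : Tuple q p) (w : Tuple p r) :
    (affine v).comp (affine w) = affine (affine v ∘ w) := by
  ext1 t
  apply Subtype.ext
  simp only [ContinuousMap.comp_apply, coe_affine, Function.comp_apply, Finset.sum_apply,
    Pi.smul_apply, smul_eq_mul, Finset.sum_smul, Finset.smul_sum, smul_smul]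
  rw [Finset.sum_comm]

lemma stdMap_eq_affine {p q : ℕ} (f : Fin (p + 1) → Fin (q + 1)) :
    stdMap f = affine (vertices q ∘ f) := by
  ext1 t
  apply Subtype.ext
  ext j
  simp only [coe_affine, Function.comp_apply, vertices, Finset.sum_apply, Pi.smul_apply,
    smul_eq_mul, Pi.single_apply, mul_ite, mul_one, mul_zero]
  change FunOnFinite.linearMap ℝ ℝ f t j = _
  rw [FunOnFinite.linearMap_apply_apply, Finset.sum_filter]
  simp only [eq_comm]
  rfl

/-- The boundary operator on chains of tuples. -/
def tupleBd {q p : ℕ} : (Tuple q (p + 1) →₀ ℚ) →ₗ[ℚ] (Tuple q p →₀ ℚ) :=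
  altBd (S := Tuple q) (fun _ i v ↦ v ∘ i.succAbove) p

lemma tupleBd_single {q p : ℕ} (v : Tuple q (p + 1)) (c : ℚ) :
    tupleBd (single v c) =
      c • ∑ i : Fin (p + 2), single (v ∘ i.succAbove : Tuple q p) ((-1 : ℚ) ^ (i : ℕ)) :=
  altBd_single (S := Tuple q) _ p v c

lemma tupleBd_tupleBd {q p : ℕ} (z : Tuple q (p + 2) →₀ ℚ) : tupleBd (tupleBd z) = 0 := by
  refine altBd_altBd (S := Tuple q) _ (fun p i j h v ↦ ?_) p z
  change (v ∘ _) ∘ _ = (v ∘ _) ∘ _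
  rw [Function.comp_assoc, Function.comp_assoc, succAbove_comp_succAbove i j h]

/-- The cone operator on chains of tuples. -/
def cone {q p : ℕ} (b : stdSimplex ℝ (Fin (q + 1))) :
    (Tuple q p →₀ ℚ) →ₗ[ℚ] (Tuple q (p + 1) →₀ ℚ) :=
  lmapDomain ℚ ℚ fun v ↦ Fin.cons b v

@[simp]
lemma cone_single {q p : ℕ} (b : stdSimplex ℝ (Fin (q + 1))) (v : Tuple q p) (c : ℚ) :
    cone b (single v c) = single (Fin.cons b v : Tuple q (p + 1)) c := by
  simp [cone]

lemma tupleBd_cone {q p : ℕ} (b : stdSimplex ℝ (Fin (q + 1))) (z : Tuple q (p + 1) →₀ ℚ) :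
    tupleBd (cone b z) = z - cone b (tupleBd z) := by
  suffices tupleBd ∘ₗ cone b = LinearMap.id - cone b ∘ₗ tupleBd (q := q) (p := p) from
    LinearMap.congr_fun this z
  ext1 v
  ext1
  simp only [LinearMap.comp_apply, lsingle_apply, cone_single, tupleBd_single,
    LinearMap.sub_apply, LinearMap.id_apply, one_smul, map_sum]
  rw [Fin.sum_univ_succ, sub_eq_add_neg, ← Finset.sum_neg_distrib]
  refine congrArg₂ (· + ·) (by simp) ?_
  · refine Finset.sum_congr rfl fun i _ ↦ ?_
    rw [← single_neg]
    congr 1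
    · funext k
      refine Fin.cases ?_ (fun k ↦ ?_) k <;> simp
    · simp [pow_succ]

lemma tupleBd_single_one {q : ℕ} (v : Tuple q 1) (c : ℚ) :
    tupleBd (single v c) =
      c • (single (fun _ ↦ v 1 : Tuple q 0) 1 - single (fun _ ↦ v 0 : Tuple q 0) 1) := by
  have h (w w' : Tuple q 0) (h : w 0 = w' 0) : w = w' := by
    funext k
    rw [show k = (0 : Fin 1) from Fin.fin_one_eq_zero k, h]
  rw [tupleBd_single, Fin.sum_univ_succ, Fin.sum_univ_succ, Fin.sum_univ_zero]
  rw [h (v ∘ (0 : Fin 2).succAbove) (fun _ ↦ v 1) rfl,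
    h (v ∘ (Fin.succ (0 : Fin 1)).succAbove) (fun _ ↦ v 0) rfl]
  simp [sub_eq_add_neg]

lemma tupleBd_cone_tupleBd_single {q : ℕ} (b : stdSimplex ℝ (Fin (q + 1))) (v : Tuple q 1) :
    tupleBd (cone b (tupleBd (single v 1))) = tupleBd (single v 1) := by
  have h (x : stdSimplex ℝ (Fin (q + 1))) :
      (Fin.cons b (fun _ : Fin 1 ↦ x) : Tuple q 1) 1 = x := rfl
  rw [tupleBd_single_one]
  simp only [one_smul, map_sub, cone_single, tupleBd_single_one, h, Fin.cons_zero]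
  abel

/-- The barycenter of a tuple. -/
def bary {q p : ℕ} (v : Tuple q p) : stdSimplex ℝ (Fin (q + 1)) := affine v stdSimplex.barycenter

lemma affine_bary {p q r : ℕ} (v : Tuple q p) (w : Tuple p r) :
    affine v (bary w) = bary (affine v ∘ w) := by
  rw [bary, bary, ← affine_comp_affine]
  rfl

/-- Barycentric subdivision of chains of tuples. -/
def sd {q : ℕ} : ∀ p, (Tuple q p →₀ ℚ) →ₗ[ℚ] (Tuple q p →₀ ℚ)
  | 0 => LinearMap.id
  | p + 1 => linearCombination ℚ fun v ↦ cone (bary v) (sd p (tupleBd (single v 1)))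

/-- The natural chain homotopy between the identity and barycentric subdivision. -/
def sdHomotopy {q : ℕ} : ∀ p, (Tuple q p →₀ ℚ) →ₗ[ℚ] (Tuple q (p + 1) →₀ ℚ)
  | 0 => 0
  | p + 1 => linearCombination ℚ fun v ↦
      cone (bary v) (single v 1 - sdHomotopy p (tupleBd (single v 1)))

lemma sd_succ_single {q p : ℕ} (v : Tuple q (p + 1)) :
    sd (p + 1) (single v 1) = cone (bary v) (sd p (tupleBd (single v 1))) := by
  simp [sd]

lemma sdHomotopy_succ_single {q p : ℕ} (v : Tuple q (p + 1)) :
    sdHomotopy (p + 1) (single v 1) =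
      cone (bary v) (single v 1 - sdHomotopy p (tupleBd (single v 1))) := by
  simp [sdHomotopy]

lemma tupleBd_sd {q p : ℕ} (z : Tuple q (p + 1) →₀ ℚ) :
    tupleBd (sd (p + 1) z) = sd p (tupleBd z) := by
  induction p with
  | zero =>
    suffices tupleBd ∘ₗ sd 1 = sd 0 ∘ₗ tupleBd (q := q) from LinearMap.congr_fun this z
    ext1 v
    ext1
    simp only [LinearMap.comp_apply, lsingle_apply, sd_succ_single]
    exact tupleBd_cone_tupleBd_single _ v
  | succ p ih =>
    suffices tupleBd ∘ₗ sd (p + 2) = sd (p + 1) ∘ₗ tupleBd (q := q) from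
      LinearMap.congr_fun this z
    ext1 v
    ext1
    simp only [LinearMap.comp_apply, lsingle_apply, sd_succ_single]
    rw [tupleBd_cone, ih, tupleBd_tupleBd, map_zero, map_zero, sub_zero]

lemma tupleBd_sdHomotopy_zero {q : ℕ} (z : Tuple q 0 →₀ ℚ) :
    tupleBd (sdHomotopy 0 z) = z - sd 0 z := by
  simp [sd, sdHomotopy]

lemma tupleBd_sdHomotopy {q p : ℕ} (z : Tuple q (p + 1) →₀ ℚ) :
    tupleBd (sdHomotopy (p + 1) z) = z - sd (p + 1) z - sdHomotopy p (tupleBd z) := by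
  suffices tupleBd ∘ₗ sdHomotopy (p + 1) =
      LinearMap.id - sd (p + 1) - sdHomotopy p ∘ₗ tupleBd (q := q) from
    LinearMap.congr_fun this z
  have key (v : Tuple q (p + 1)) :
      tupleBd (sdHomotopy p (tupleBd (single v 1))) =
        tupleBd (single v 1) - sd p (tupleBd (single v 1)) := by
    cases p with
    | zero => exact tupleBd_sdHomotopy_zero _
    | succ p =>
      rw [tupleBd_sdHomotopy (tupleBd (single v 1)), tupleBd_tupleBd, map_zero, sub_zero]
  ext1 v
  ext1
  simp only [LinearMap.comp_apply, lsingle_apply, LinearMap.sub_apply, LinearMap.id_apply,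
    sdHomotopy_succ_single, sd_succ_single]
  rw [tupleBd_cone, map_sub tupleBd, key, sub_sub_cancel]
  abel

/-- The map induced on chains of tuples by an affine map. -/
def pushTuple {p q r : ℕ} (u : Tuple r q) : (Tuple q p →₀ ℚ) →ₗ[ℚ] (Tuple r p →₀ ℚ) :=
  lmapDomain ℚ ℚ fun v ↦ affine u ∘ v

@[simp]
lemma pushTuple_single {p q r : ℕ} (u : Tuple r q) (v : Tuple q p) (c : ℚ) :
    pushTuple u (single v c) = single (affine u ∘ v : Tuple r p) c := by
  simp [pushTuple]

lemma tupleBd_pushTuple {p q r : ℕ} (u : Tuple r q) (z : Tuple q (p + 1) →₀ ℚ) :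
    tupleBd (pushTuple u z) = pushTuple u (tupleBd z) :=
  altBd_lmapDomain (S := Tuple q) (T := Tuple r) _ _ (fun _ v ↦ affine u ∘ v)
    (fun _ _ _ ↦ rfl) p z

lemma pushTuple_cone {p q r : ℕ} (u : Tuple r q) (b : stdSimplex ℝ (Fin (q + 1)))
    (z : Tuple q p →₀ ℚ) : pushTuple u (cone b z) = cone (affine u b) (pushTuple u z) := by
  suffices pushTuple u ∘ₗ cone b = cone (affine u b) ∘ₗ pushTuple u (p := p) from
    LinearMap.congr_fun this z
  ext1 v
  ext1
  simp only [LinearMap.comp_apply, lsingle_apply, cone_single, pushTuple_single]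
  congr 1
  funext k
  refine Fin.cases ?_ (fun k ↦ ?_) k <;> simp

lemma pushTuple_sd {p q r : ℕ} (u : Tuple r q) (z : Tuple q p →₀ ℚ) :
    pushTuple u (sd p z) = sd p (pushTuple u z) := by
  induction p with
  | zero => rfl
  | succ p ih =>
    suffices pushTuple u ∘ₗ sd (p + 1) = sd (p + 1) ∘ₗ pushTuple u from
      LinearMap.congr_fun this z
    ext1 v
    ext1
    simp only [LinearMap.comp_apply, lsingle_apply, pushTuple_single, sd_succ_single]
    rw [pushTuple_cone, ih, affine_bary, ← tupleBd_pushTuple, pushTuple_single]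

lemma pushTuple_sdHomotopy {p q r : ℕ} (u : Tuple r q) (z : Tuple q p →₀ ℚ) :
    pushTuple u (sdHomotopy p z) = sdHomotopy p (pushTuple u z) := by
  induction p with
  | zero => simp [sdHomotopy]
  | succ p ih =>
    suffices pushTuple u ∘ₗ sdHomotopy (p + 1) = sdHomotopy (p + 1) ∘ₗ pushTuple u from
      LinearMap.congr_fun this z
    ext1 v
    ext1
    simp only [LinearMap.comp_apply, lsingle_apply, pushTuple_single, sdHomotopy_succ_single]
    rw [pushTuple_cone, map_sub, ih, affine_bary, ← tupleBd_pushTuple, pushTuple_single]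

/-- The singular chain obtained by restricting a simplex to the affine simplices of a chain of
tuples. -/
def realize {p q : ℕ} (σ : Simplex q X) : (Tuple q p →₀ ℚ) →ₗ[ℚ] Chain p X :=
  lmapDomain ℚ ℚ fun v ↦ σ.comp (affine v)

@[simp]
lemma realize_single {p q : ℕ} (σ : Simplex q X) (v : Tuple q p) (c : ℚ) :
    realize σ (single v c) = single (σ.comp (affine v)) c := by
  simp [realize]

lemma bd_realize {p q : ℕ} (σ : Simplex q X) (z : Tuple q (p + 1) →₀ ℚ) :
    bd (realize σ z) = realize σ (tupleBd z) := by
  refine altBd_lmapDomain (S := Tuple q) (T := fun p ↦ Simplex p X) _ face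
    (fun _ v ↦ σ.comp (affine v)) (fun p i v ↦ ?_) p z
  change σ.comp _ = (σ.comp (affine v)).comp _
  rw [ContinuousMap.comp_assoc, stdMap_eq_affine, affine_comp_affine, ← Function.comp_assoc,
    affine_apply_vertices]

lemma realize_comp_affine {p q r : ℕ} (σ : Simplex r X) (u : Tuple r q) (z : Tuple q p →₀ ℚ) :
    realize (σ.comp (affine u)) z = realize σ (pushTuple u z) := by
  suffices realize (σ.comp (affine u)) = realize σ ∘ₗ pushTuple u (p := p) from
    LinearMap.congr_fun this z
  ext1 v
  ext1
  simp only [LinearMap.comp_apply, lsingle_apply, realize_single, pushTuple_single,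
    ContinuousMap.comp_assoc, affine_comp_affine]

lemma realize_mem_within {p q : ℕ} (σ : Simplex q X) (z : Tuple q p →₀ ℚ) {A : Set X}
    (hσ : Set.range σ ⊆ A) : realize σ z ∈ within p A := by
  refine map_mem_of_supported (s := Set.univ) _ (fun v _ ↦ ?_) (by simp)
  rw [realize_single]
  refine single_mem_within ?_ _
  rintro _ ⟨x, rfl⟩
  exact hσ ⟨_, rfl⟩

/-- Barycentric subdivision of singular chains. -/
def subdivide {p : ℕ} : Chain p X →ₗ[ℚ] Chain p X :=
  linearCombination ℚ fun σ ↦ realize σ (sd p (single (vertices p) 1))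

/-- The chain homotopy between the identity and barycentric subdivision of singular chains. -/
def subdivideHomotopy {p : ℕ} : Chain p X →ₗ[ℚ] Chain (p + 1) X :=
  linearCombination ℚ fun σ ↦ realize σ (sdHomotopy p (single (vertices p) 1))

lemma subdivide_single {p : ℕ} (σ : Simplex p X) :
    subdivide (single σ 1) = realize σ (sd p (single (vertices p) 1)) := by
  simp [subdivide]

lemma subdivideHomotopy_single {p : ℕ} (σ : Simplex p X) :
    subdivideHomotopy (single σ 1) = realize σ (sdHomotopy p (single (vertices p) 1)) := by
  simp [subdivideHomotopy]

lemma subdivide_realize {p q : ℕ} (σ : Simplex q X) (z : Tuple q p →₀ ℚ) :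
    subdivide (realize σ z) = realize σ (sd p z) := by
  suffices subdivide ∘ₗ realize σ = realize σ ∘ₗ sd p from LinearMap.congr_fun this z
  ext1 v
  ext1
  simp only [LinearMap.comp_apply, lsingle_apply, realize_single, subdivide_single,
    realize_comp_affine, pushTuple_sd, pushTuple_single, affine_apply_vertices]

lemma subdivideHomotopy_realize {p q : ℕ} (σ : Simplex q X) (z : Tuple q p →₀ ℚ) :
    subdivideHomotopy (realize σ z) = realize σ (sdHomotopy p z) := by
  suffices subdivideHomotopy ∘ₗ realize σ = realize σ ∘ₗ sdHomotopy p from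
    LinearMap.congr_fun this z
  ext1 v
  ext1
  simp only [LinearMap.comp_apply, lsingle_apply, realize_single, subdivideHomotopy_single,
    realize_comp_affine, pushTuple_sdHomotopy, pushTuple_single, affine_apply_vertices]

lemma realize_vertices {p : ℕ} (σ : Simplex p X) :
    realize σ (single (vertices p) 1) = single σ 1 := by
  rw [realize_single, affine_vertices, ContinuousMap.comp_id]

lemma bd_subdivide {p : ℕ} (z : Chain (p + 1) X) : bd (subdivide z) = subdivide (bd z) := by
  suffices bd ∘ₗ subdivide = subdivide ∘ₗ bd (X := X) (p := p) from LinearMap.congr_fun this z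
  ext1 σ
  ext1
  simp only [LinearMap.comp_apply, lsingle_apply]
  rw [← realize_vertices, subdivide_realize, bd_realize, tupleBd_sd, bd_realize, subdivide_realize]

lemma bd_subdivideHomotopy_zero (z : Chain 0 X) :
    bd (subdivideHomotopy z) = z - subdivide z := by
  suffices bd ∘ₗ subdivideHomotopy = LinearMap.id - subdivide (X := X) (p := 0) from
    LinearMap.congr_fun this z
  ext1 σ
  ext1
  simp only [LinearMap.comp_apply, lsingle_apply, LinearMap.sub_apply, LinearMap.id_apply]
  rw [← realize_vertices, subdivide_realize, subdivideHomotopy_realize, bd_realize,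
    tupleBd_sdHomotopy_zero, map_sub]

lemma bd_subdivideHomotopy {p : ℕ} (z : Chain (p + 1) X) :
    bd (subdivideHomotopy z) = z - subdivide z - subdivideHomotopy (bd z) := by
  suffices bd ∘ₗ subdivideHomotopy =
      LinearMap.id - subdivide (X := X) (p := p + 1) - subdivideHomotopy ∘ₗ bd from
    LinearMap.congr_fun this z
  ext1 σ
  ext1
  simp only [LinearMap.comp_apply, lsingle_apply, LinearMap.sub_apply, LinearMap.id_apply]
  rw [← realize_vertices, subdivide_realize, subdivideHomotopy_realize, bd_realize,
    tupleBd_sdHomotopy, bd_realize, subdivideHomotopy_realize, map_sub, map_sub]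

lemma IsCycle.bd_subdivideHomotopy {p : ℕ} {z : Chain p X} (hz : IsCycle z) :
    bd (subdivideHomotopy z) = z - subdivide z := by
  cases p with
  | zero => exact bd_subdivideHomotopy_zero z
  | succ p => rw [RatChain.bd_subdivideHomotopy, show bd z = 0 from hz, map_zero, sub_zero]

variable {X Y : Type} [TopologicalSpace X] [TopologicalSpace Y]

lemma coe_bary {q p : ℕ} (v : Tuple q p) :
    (bary v).1 = ∑ i, ((p : ℝ) + 1)⁻¹ • (v i).1 := by
  rw [bary, coe_affine]
  refine Finset.sum_congr rfl fun i _ ↦ ?_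
  congr 1
  simp [stdSimplex.barycenter]

lemma affine_mem_of_convex {q p : ℕ} {C : Set (Fin (q + 1) → ℝ)} (hC : Convex ℝ C)
    {v : Tuple q p} (hv : ∀ i, (v i).1 ∈ C) (t : stdSimplex ℝ (Fin (p + 1))) :
    (affine v t).1 ∈ C :=
  hC.sum_mem (fun i _ ↦ t.2.1 i) t.2.2 fun i _ ↦ hv i

lemma tupleBd_single_mem {q p : ℕ} {N : Submodule ℚ (Tuple q p →₀ ℚ)} (v : Tuple q (p + 1))
    (h : ∀ i : Fin (p + 2), single (v ∘ i.succAbove : Tuple q p) 1 ∈ N) :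
    tupleBd (single v 1) ∈ N := by
  rw [tupleBd_single]
  refine N.smul_mem _ (N.sum_mem fun i _ ↦ ?_)
  have := N.smul_mem ((-1 : ℚ) ^ (i : ℕ)) (h i)
  simpa using this

lemma map_tupleBd_single_mem {q p : ℕ} {M : Type} [AddCommGroup M] [Module ℚ M]
    (f : (Tuple q p →₀ ℚ) →ₗ[ℚ] M) {N : Submodule ℚ M} (v : Tuple q (p + 1))
    (h : ∀ i : Fin (p + 2), f (single (v ∘ i.succAbove : Tuple q p) 1) ∈ N) :
    f (tupleBd (single v 1)) ∈ N :=
  tupleBd_single_mem (N := N.comap f) v h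

lemma cone_mem_supported {q p : ℕ} {b : stdSimplex ℝ (Fin (q + 1))} {s : Set (Tuple q p)}
    {t : Set (Tuple q (p + 1))} (h : ∀ v ∈ s, (Fin.cons b v : Tuple q (p + 1)) ∈ t)
    {z : Tuple q p →₀ ℚ} (hz : z ∈ supported ℚ ℚ s) : cone b z ∈ supported ℚ ℚ t := by
  refine map_mem_of_supported _ (fun v hv ↦ ?_) hz
  rw [cone_single]
  exact single_mem_supported ℚ _ (h v hv)

lemma sd_mem_supported_of_convex {q p : ℕ} {C : Set (Fin (q + 1) → ℝ)} (hC : Convex ℝ C)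
    {v : Tuple q p} (hv : ∀ i, (v i).1 ∈ C) :
    sd p (single v 1) ∈ supported ℚ ℚ {w : Tuple q p | ∀ i, (w i).1 ∈ C} := by
  induction p with
  | zero => exact single_mem_supported ℚ _ hv
  | succ p ih =>
    rw [sd_succ_single]
    refine cone_mem_supported (fun w hw ↦ ?_)
      (map_tupleBd_single_mem (sd p) v fun i ↦ ih fun j ↦ hv _)
    refine Fin.cases ?_ fun k ↦ ?_
    · exact affine_mem_of_convex hC hv _
    · exact hw k

/-- The tuples of diameter at most `r`. -/
def diamLE (q p : ℕ) (r : ℝ) : Set (Tuple q p) := {v | ∀ i j, dist (v i) (v j) ≤ r}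

lemma dist_bary_le {q p : ℕ} {r : ℝ} {v : Tuple q p} (hv : v ∈ diamLE q p r) (j : Fin (p + 1)) :
    dist (v j) (bary v) ≤ p / (p + 1) * r := by
  rw [Subtype.dist_eq, dist_comm, dist_eq_norm]
  have hp : (0 : ℝ) < p + 1 := by positivity
  have e : (bary v).1 - (v j).1 = ∑ i, ((p : ℝ) + 1)⁻¹ • ((v i).1 - (v j).1) := by
    rw [coe_bary]
    simp only [smul_sub, Finset.sum_sub_distrib]
    congr 1
    rw [← Finset.sum_smul]
    simp [hp.ne']
  rw [e, ← Finset.add_sum_erase _ _ (Finset.mem_univ j)]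
  simp only [sub_self, smul_zero, zero_add]
  refine (norm_sum_le_of_le (Finset.univ.erase j) (n := fun _ ↦ ((p : ℝ) + 1)⁻¹ * r)
    fun i _ ↦ ?_).trans ?_
  · rw [norm_smul, Real.norm_of_nonneg (by positivity), ← dist_eq_norm]
    gcongr
    exact hv i j
  · simp [Finset.card_erase_of_mem]
    apply le_of_eq
    field_simp

lemma sd_single_mem_diamLE {q p : ℕ} {r : ℝ} (hr : 0 ≤ r) {v : Tuple q p}
    (hv : v ∈ diamLE q p r) :
    sd p (single v 1) ∈ supported ℚ ℚ (diamLE q p (p / (p + 1) * r)) := by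
  induction p with
  | zero =>
    refine single_mem_supported ℚ _ fun i j ↦ ?_
    rw [Subsingleton.elim (α := Fin 1) i j]
    simp
  | succ p ih =>
    rw [sd_succ_single]
    have hb := dist_bary_le hv
    set b := bary v
    set c : ℝ := ((p + 1 : ℕ) : ℝ) / ((p + 1 : ℕ) + 1) * r
    have hc : 0 ≤ c := by positivity
    have hpc : (p : ℝ) / (p + 1) * r ≤ c := by
      refine mul_le_mul_of_nonneg_right ?_ hr
      push_cast
      rw [div_le_div_iff₀ (by positivity) (by positivity)]
      nlinarith
    refine cone_mem_supported
      (s := diamLE q p (p / (p + 1) * r) ∩ {w | ∀ i, (w i).1 ∈ Metric.closedBall b.1 c}) ?_ ?_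
    · rintro w ⟨hw, hw'⟩
      refine Fin.cases (Fin.cases ?_ fun j ↦ ?_) fun i ↦ Fin.cases ?_ fun j ↦ ?_
      · simpa using hc
      · exact (dist_comm _ _).trans_le (hw' j)
      · exact hw' i
      · simpa using (hw i j).trans hpc
    · refine map_tupleBd_single_mem (sd p) v fun i ↦ ?_
      rw [supported_inter]
      exact ⟨ih fun j k ↦ hv _ _,
        sd_mem_supported_of_convex (convex_closedBall _ _) fun j ↦ hb _⟩

lemma sd_mem_diamLE {q p : ℕ} {r : ℝ} (hr : 0 ≤ r) {z : Tuple q p →₀ ℚ}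
    (hz : z ∈ supported ℚ ℚ (diamLE q p r)) :
    sd p z ∈ supported ℚ ℚ (diamLE q p (p / (p + 1) * r)) :=
  map_mem_of_supported _ (fun _ hv ↦ sd_single_mem_diamLE hr hv) hz

lemma sd_pow_mem_diamLE {q p : ℕ} {r : ℝ} (hr : 0 ≤ r) {z : Tuple q p →₀ ℚ}
    (hz : z ∈ supported ℚ ℚ (diamLE q p r)) (m : ℕ) :
    (sd p ^ m : Module.End ℚ _) z ∈ supported ℚ ℚ (diamLE q p ((p / (p + 1)) ^ m * r)) := by
  induction m with
  | zero => simpa using hz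
  | succ m ih =>
    rw [pow_succ' (sd p), Module.End.mul_apply, pow_succ', mul_assoc]
    exact sd_mem_diamLE (by positivity) ih

/-- The chains all of whose simplices lie in some member of a family of sets. -/
def small {ι : Type} (p : ℕ) (U : ι → Set X) : Submodule ℚ (Chain p X) :=
  supported ℚ ℚ {σ : Simplex p X | ∃ i, Set.range σ ⊆ U i}

lemma within_le_small {ι : Type} (p : ℕ) (U : ι → Set X) (i : ι) : within p (U i) ≤ small p U :=
  supported_mono fun _ h ↦ ⟨i, h⟩

lemma subdivide_mem_small {ι : Type} {p : ℕ} {U : ι → Set X} {z : Chain p X}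
    (hz : z ∈ small p U) : subdivide z ∈ small p U := by
  refine map_mem_of_supported _ (fun σ hσ ↦ ?_) hz
  obtain ⟨i, hσ⟩ := hσ
  rw [subdivide_single]
  exact within_le_small p U i (realize_mem_within _ _ hσ)

lemma subdivideHomotopy_mem_small {ι : Type} {p : ℕ} {U : ι → Set X} {z : Chain p X}
    (hz : z ∈ small p U) : subdivideHomotopy z ∈ small (p + 1) U := by
  refine map_mem_of_supported _ (fun σ hσ ↦ ?_) hz
  obtain ⟨i, hσ⟩ := hσ
  rw [subdivideHomotopy_single]
  exact within_le_small _ U i (realize_mem_within _ _ hσ)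

lemma subdivide_pow_realize {p q : ℕ} (σ : Simplex q X) (z : Tuple q p →₀ ℚ) (m : ℕ) :
    (subdivide ^ m : Module.End ℚ _) (realize σ z) =
      realize σ ((sd p ^ m : Module.End ℚ _) z) := by
  induction m with
  | zero => rfl
  | succ m ih =>
    rw [pow_succ', Module.End.mul_apply, ih, subdivide_realize, pow_succ', Module.End.mul_apply]

lemma subdivide_pow_mem_small {ι : Type} {p : ℕ} {U : ι → Set X} {z : Chain p X}
    (hz : z ∈ small p U) (m : ℕ) : (subdivide ^ m : Module.End ℚ _) z ∈ small p U := by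
  induction m with
  | zero => exact hz
  | succ m ih =>
    rw [pow_succ', Module.End.mul_apply]
    exact subdivide_mem_small ih

lemma exists_subdivide_pow_single_mem_small {ι : Type} {p : ℕ} {U : ι → Set X}
    (hU : ∀ i, IsOpen (U i)) (hU' : ⋃ i, U i = Set.univ) (σ : Simplex p X) :
    ∃ m, (subdivide ^ m : Module.End ℚ _) (single σ 1) ∈ small p U := by
  obtain ⟨δ, hδ, h⟩ := lebesgue_number_lemma_of_metric
    (s := (Set.univ : Set (stdSimplex ℝ (Fin (p + 1))))) (c := fun i ↦ σ ⁻¹' U i) isCompact_univ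
    (fun i ↦ (hU i).preimage σ.continuous)
    (by rw [← Set.preimage_iUnion, hU', Set.preimage_univ])
  have hlim : Filter.Tendsto (fun m ↦ ((p : ℝ) / (p + 1)) ^ m * Metric.diam
      (Set.univ : Set (stdSimplex ℝ (Fin (p + 1))))) Filter.atTop (nhds 0) := by
    simpa using (tendsto_pow_atTop_nhds_zero_of_lt_one (r := (p : ℝ) / (p + 1)) (by positivity)
      (by rw [div_lt_one (by positivity)]; linarith)).mul_const _
  obtain ⟨m, hm⟩ := (hlim.eventually_lt_const hδ).exists
  refine ⟨m, ?_⟩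
  rw [← realize_vertices, subdivide_pow_realize]
  refine map_mem_of_supported _ (fun w hw ↦ ?_) (sd_pow_mem_diamLE (r := Metric.diam
    (Set.univ : Set (stdSimplex ℝ (Fin (p + 1))))) Metric.diam_nonneg
    (single_mem_supported ℚ _ fun i j ↦ ?_) m)
  · obtain ⟨i, hi⟩ := h (w 0) trivial
    rw [realize_single]
    refine within_le_small p U i (single_mem_within ?_ _)
    rintro _ ⟨t, rfl⟩
    refine hi ?_
    rw [Metric.mem_ball]
    refine lt_of_le_of_lt ?_ hm
    exact affine_mem_of_convex (convex_closedBall (w 0).1 _) (fun i ↦ hw i 0) t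
  · exact Metric.dist_le_diam_of_mem isCompact_univ.isBounded trivial trivial

lemma exists_subdivide_pow_mem_small {ι : Type} {p : ℕ} {U : ι → Set X}
    (hU : ∀ i, IsOpen (U i)) (hU' : ⋃ i, U i = Set.univ) (z : Chain p X) :
    ∃ m, (subdivide ^ m : Module.End ℚ _) z ∈ small p U := by
  induction z using Finsupp.induction_linear with
  | zero => exact ⟨0, by simp⟩
  | add z w hz hw =>
    obtain ⟨m, hm⟩ := hz
    obtain ⟨k, hk⟩ := hw
    refine ⟨k + m, ?_⟩
    rw [map_add]
    refine add_mem ?_ ?_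
    · rw [pow_add]
      exact subdivide_pow_mem_small hm k
    · rw [add_comm, pow_add]
      exact subdivide_pow_mem_small hk m
  | single σ c =>
    obtain ⟨m, hm⟩ := exists_subdivide_pow_single_mem_small hU hU' σ
    refine ⟨m, ?_⟩
    rw [← mul_one c, ← smul_eq_mul, ← smul_single, map_smul]
    exact Submodule.smul_mem _ _ hm

lemma bd_subdivide_pow {p : ℕ} (z : Chain (p + 1) X) (m : ℕ) :
    bd ((subdivide ^ m : Module.End ℚ _) z) = (subdivide ^ m : Module.End ℚ _) (bd z) := by
  induction m with
  | zero => rfl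
  | succ m ih =>
    rw [pow_succ', Module.End.mul_apply, bd_subdivide, ih, pow_succ', Module.End.mul_apply]

lemma IsCycle.subdivide_pow {p : ℕ} {z : Chain p X} (hz : IsCycle z) (m : ℕ) :
    IsCycle ((subdivide ^ m : Module.End ℚ _) z) := by
  cases p with
  | zero => trivial
  | succ p =>
    change bd _ = 0
    rw [bd_subdivide_pow, show bd z = 0 from hz, map_zero]

lemma IsCycle.exists_bd_eq_sub_subdivide_pow {ι : Type} {p : ℕ} {z : Chain p X} (hz : IsCycle z)
    (U : ι → Set X) (m : ℕ) :
    ∃ w, bd w = z - (subdivide ^ m : Module.End ℚ _) z ∧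
      (z ∈ small p U → w ∈ small (p + 1) U) := by
  induction m with
  | zero => exact ⟨0, by simp, fun _ ↦ zero_mem _⟩
  | succ m ih =>
    obtain ⟨w, hw, hw'⟩ := ih
    refine ⟨w + subdivideHomotopy ((subdivide ^ m : Module.End ℚ _) z), ?_, fun h ↦
      add_mem (hw' h) (subdivideHomotopy_mem_small (subdivide_pow_mem_small h m))⟩
    rw [map_add, (hz.subdivide_pow m).bd_subdivideHomotopy, hw, pow_succ', Module.End.mul_apply]
    abel

/-- Every cycle is homologous to a cycle of small simplices. -/
lemma IsCycle.exists_small {ι : Type} {p : ℕ} {U : ι → Set X}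
    (hU : ∀ i, IsOpen (U i)) (hU' : ⋃ i, U i = Set.univ) {z : Chain p X} (hz : IsCycle z) :
    ∃ z' ∈ small p U, IsCycle z' ∧ ∃ w, bd w = z - z' := by
  obtain ⟨m, hm⟩ := exists_subdivide_pow_mem_small hU hU' z
  obtain ⟨w, hw, -⟩ := hz.exists_bd_eq_sub_subdivide_pow U m
  exact ⟨_, hm, hz.subdivide_pow m, w, hw⟩

/-- A cycle of small simplices which is a boundary bounds a chain of small simplices. -/
lemma exists_small_bd_eq {ι : Type} {p : ℕ} {U : ι → Set X}
    (hU : ∀ i, IsOpen (U i)) (hU' : ⋃ i, U i = Set.univ) (w : Chain (p + 1) X)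
    (hw : bd w ∈ small p U) : ∃ w' ∈ small (p + 1) U, bd w' = bd w := by
  obtain ⟨m, hm⟩ := exists_subdivide_pow_mem_small hU hU' w
  obtain ⟨h, hh, hh'⟩ := (isCycle_bd w).exists_bd_eq_sub_subdivide_pow U m
  refine ⟨h + (subdivide ^ m : Module.End ℚ _) w, add_mem (hh' hw) hm, ?_⟩
  rw [map_add, hh, bd_subdivide_pow, sub_add_cancel]

section HomologyMap

variable {K L : ChainComplex (ModuleCat ℚ) ℕ} {i j k : ℕ}

lemma exists_iCycles_eq (hk : (ComplexShape.down ℕ).next j = k) (x : K.X j)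
    (hx : K.d j k x = 0) : ∃ c, K.iCycles j c = x :=
  (ShortComplex.moduleCat_exact_iff _).1
    (ShortComplex.exact_of_f_is_kernel (ShortComplex.mk _ _ (K.iCycles_d j k))
      (K.cyclesIsKernel j k hk)) x hx

lemma exists_toCycles_eq (hi : (ComplexShape.down ℕ).prev j = i) (c : K.cycles j)
    (hc : K.homologyπ j c = 0) : ∃ w, K.toCycles i j w = c :=
  (ShortComplex.moduleCat_exact_iff _).1
    (ShortComplex.exact_of_g_is_cokernel (ShortComplex.mk _ _ (K.toCycles_comp_homologyπ i j))
      (K.homologyIsCokernel i j hi)) c hc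

lemma homologyπ_surjective : Function.Surjective (K.homologyπ j) :=
  (ModuleCat.epi_iff_surjective _).1 inferInstance

lemma iCycles_injective : Function.Injective (K.iCycles j) :=
  (ModuleCat.mono_iff_injective _).1 inferInstance

lemma homologyπ_naturality_apply (φ : K ⟶ L) (c : K.cycles j) :
    HomologicalComplex.homologyMap φ j (K.homologyπ j c) =
      L.homologyπ j (HomologicalComplex.cyclesMap φ j c) :=
  ConcreteCategory.congr_hom (HomologicalComplex.homologyπ_naturality φ j) c

lemma cyclesMap_i_apply (φ : K ⟶ L) (c : K.cycles j) :
    L.iCycles j (HomologicalComplex.cyclesMap φ j c) = φ.f j (K.iCycles j c) :=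
  ConcreteCategory.congr_hom (HomologicalComplex.cyclesMap_i φ j) c

lemma toCycles_i_apply (w : K.X i) : K.iCycles j (K.toCycles i j w) = K.d i j w :=
  ConcreteCategory.congr_hom (K.toCycles_i i j) w

lemma iCycles_d_apply (c : K.cycles j) : K.d j k (K.iCycles j c) = 0 :=
  ConcreteCategory.congr_hom (K.iCycles_d j k) c

lemma homologyπ_toCycles_apply (w : K.X i) : K.homologyπ j (K.toCycles i j w) = 0 :=
  ConcreteCategory.congr_hom (K.toCycles_comp_homologyπ i j) w

lemma isIso_homologyMap (φ : K ⟶ L) (hi : (ComplexShape.down ℕ).prev j = i)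
    (hk : (ComplexShape.down ℕ).next j = k)
    (hsurj : ∀ y : L.X j, L.d j k y = 0 → ∃ x, K.d j k x = 0 ∧ ∃ w, L.d i j w = y - φ.f j x)
    (hinj : ∀ x : K.X j, K.d j k x = 0 → (∃ w, L.d i j w = φ.f j x) → ∃ v, K.d i j v = x) :
    IsIso (HomologicalComplex.homologyMap φ j) := by
  rw [ConcreteCategory.isIso_iff_bijective]
  constructor
  · rw [injective_iff_map_eq_zero]
    intro a ha
    obtain ⟨c, rfl⟩ := homologyπ_surjective a
    rw [homologyπ_naturality_apply] at ha
    obtain ⟨w, hw⟩ := exists_toCycles_eq hi _ ha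
    obtain ⟨v, hv⟩ := hinj (K.iCycles j c) (iCycles_d_apply c)
      ⟨w, by rw [← toCycles_i_apply, hw, cyclesMap_i_apply]⟩
    rw [← iCycles_injective ((toCycles_i_apply v).trans hv), homologyπ_toCycles_apply]
  · intro b
    obtain ⟨c, rfl⟩ := homologyπ_surjective b
    obtain ⟨x, hx, w, hw⟩ := hsurj (L.iCycles j c) (iCycles_d_apply c)
    obtain ⟨a, rfl⟩ := exists_iCycles_eq hk x hx
    refine ⟨K.homologyπ j a, ?_⟩
    rw [homologyπ_naturality_apply]
    have : L.toCycles i j w = c - HomologicalComplex.cyclesMap φ j a := by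
      apply iCycles_injective
      rw [toCycles_i_apply, hw, map_sub, cyclesMap_i_apply]
    have h := homologyπ_toCycles_apply (j := j) w
    rw [this, map_sub, sub_eq_zero] at h
    exact h.symm

end HomologyMap

variable {X Y : Type} [TopologicalSpace X] [TopologicalSpace Y]

/-- The identification of the chains in the singular chain complex. -/
def chainEquiv (X : Type) [TopologicalSpace X] (p : ℕ) :
    (singularChainComplexQ (TopCat.of X)).X p ≃ₗ[ℚ] Chain p X :=
  Finsupp.domLCongr ((TopCat.of X).toSSetObjEquiv (Opposite.op (SimplexCategory.mk p)))

lemma chainEquiv_single {p : ℕ}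
    (σ : (TopCat.toSSet.obj (TopCat.of X)).obj (Opposite.op (SimplexCategory.mk p))) (c : ℚ) :
    chainEquiv X p (single σ c) = single ((TopCat.of X).toSSetObjEquiv _ σ) c :=
  Finsupp.domLCongr_single _ _ _

lemma hom_sum_zsmul_apply {A B : ModuleCat ℚ} {n : ℕ} (c : Fin n → ℤ) (f : Fin n → (A ⟶ B))
    (a : A) : (∑ i, c i • f i).hom a = ∑ i, c i • (f i).hom a := by
  simp [ModuleCat.hom_sum, LinearMap.sum_apply]

lemma chainEquiv_d {p : ℕ} (x : (singularChainComplexQ (TopCat.of X)).X (p + 1)) :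
    chainEquiv X p ((singularChainComplexQ (TopCat.of X)).d (p + 1) p x) =
      bd (chainEquiv X (p + 1) x) := by
  suffices (chainEquiv X p).toLinearMap ∘ₗ
      ((singularChainComplexQ (TopCat.of X)).d (p + 1) p).hom =
        bd ∘ₗ (chainEquiv X (p + 1)).toLinearMap from LinearMap.congr_fun this x
  refine Finsupp.lhom_ext' fun σ ↦ LinearMap.ext_ring ?_
  change chainEquiv X p ((singularChainComplexQ (TopCat.of X)).d (p + 1) p (single σ 1)) =
    bd (chainEquiv X (p + 1) (single σ 1))
  rw [chainEquiv_single, bd_single, one_smul]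
  have e : (singularChainComplexQ (TopCat.of X)).d (p + 1) p =
      ∑ i : Fin (p + 2), (-1 : ℤ) ^ (i : ℕ) • (ModuleCat.free ℚ).map
        ((TopCat.toSSet.obj (TopCat.of X)).δ i) :=
    AlgebraicTopology.alternatingFaceMapComplex_obj_d _ _
  have e' (i : Fin (p + 2)) : ((ModuleCat.free ℚ).map
      ((TopCat.toSSet.obj (TopCat.of X)).δ i)).hom (single σ 1) =
      single ((TopCat.toSSet.obj (TopCat.of X)).δ i σ) 1 := Finsupp.mapDomain_single
  have e₁ : (∑ i : Fin (p + 2), (-1 : ℤ) ^ (i : ℕ) • (ModuleCat.free ℚ).map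
      ((TopCat.toSSet.obj (TopCat.of X)).δ i)).hom (single σ 1) =
      ∑ i : Fin (p + 2), (-1 : ℤ) ^ (i : ℕ) •
        single ((TopCat.toSSet.obj (TopCat.of X)).δ i σ) (1 : ℚ) := 
    (hom_sum_zsmul_apply _ _ _).trans (Finset.sum_congr rfl fun i _ ↦ congrArg (_ • ·) (e' i))
  have e₂ : (singularChainComplexQ (TopCat.of X)).d (p + 1) p (single σ 1) =
      ∑ i : Fin (p + 2), (-1 : ℤ) ^ (i : ℕ) •
        single ((TopCat.toSSet.obj (TopCat.of X)).δ i σ) (1 : ℚ) :=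
    (congrArg (fun φ ↦ ModuleCat.Hom.hom φ (single σ 1)) e).trans e₁
  refine (congrArg (chainEquiv X p) e₂).trans ?_
  refine (map_sum (chainEquiv X p) _ _).trans (Finset.sum_congr rfl fun i _ ↦ ?_)
  refine (map_zsmul (chainEquiv X p) _ _).trans ?_
  have e'' : (TopCat.of X).toSSetObjEquiv _ ((TopCat.toSSet.obj (TopCat.of X)).δ i σ) =
      face p i ((TopCat.of X).toSSetObjEquiv _ σ) := by
    exact ContinuousMap.ext fun z ↦ TopCat.toSSetObjEquiv_δ_apply σ i z
  rw [chainEquiv_single, e'', ← Int.cast_smul_eq_zsmul ℚ, smul_single]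
  simp

lemma chainEquiv_map {p : ℕ} (f : C(X, Y)) (x : (singularChainComplexQ (TopCat.of X)).X p) :
    chainEquiv Y p (((AlgebraicTopology.alternatingFaceMapComplex (ModuleCat ℚ)).map
      (((SimplicialObject.whiskering _ _).obj (ModuleCat.free ℚ)).map
        (TopCat.toSSet.map (TopCat.ofHom f)))).f p x) = push f (chainEquiv X p x) := by
  suffices (chainEquiv Y p).toLinearMap ∘ₗ
      (((AlgebraicTopology.alternatingFaceMapComplex (ModuleCat ℚ)).map
        (((SimplicialObject.whiskering _ _).obj (ModuleCat.free ℚ)).map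
          (TopCat.toSSet.map (TopCat.ofHom f)))).f p).hom =
        push f ∘ₗ (chainEquiv X p).toLinearMap from LinearMap.congr_fun this x
  refine Finsupp.lhom_ext' fun σ ↦ LinearMap.ext_ring ?_
  have e : (((AlgebraicTopology.alternatingFaceMapComplex (ModuleCat ℚ)).map
        (((SimplicialObject.whiskering _ _).obj (ModuleCat.free ℚ)).map
          (TopCat.toSSet.map (TopCat.ofHom f)))).f p).hom (single σ 1) =
      single ((TopCat.toSSet.map (TopCat.ofHom f)).app _ σ) 1 := Finsupp.mapDomain_single
  change chainEquiv Y p ((((AlgebraicTopology.alternatingFaceMapComplex (ModuleCat ℚ)).map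
        (((SimplicialObject.whiskering _ _).obj (ModuleCat.free ℚ)).map
          (TopCat.toSSet.map (TopCat.ofHom f)))).f p).hom (single σ 1)) =
    push f (chainEquiv X p (single σ 1))
  rw [e, chainEquiv_single, chainEquiv_single, push_single]
  rfl

/-- The map on singular chain complexes induced by a continuous map. -/
def chainComplexMap (f : C(X, Y)) :
    singularChainComplexQ (TopCat.of X) ⟶ singularChainComplexQ (TopCat.of Y) :=
  (AlgebraicTopology.alternatingFaceMapComplex (ModuleCat ℚ)).map
    (((SimplicialObject.whiskering _ _).obj (ModuleCat.free ℚ)).map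
      (TopCat.toSSet.map (TopCat.ofHom f)))

/-- Criterion for a continuous map to induce an isomorphism on homology, in terms of cycles
and boundaries. -/
lemma nonempty_singularHomologyQ_iso (f : C(X, Y)) (p : ℕ)
    (hsurj : ∀ y : Chain p Y, IsCycle y → ∃ x : Chain p X, IsCycle x ∧
      ∃ w, bd w = y - push f x)
    (hinj : ∀ x : Chain p X, IsCycle x → (∃ w, bd w = push f x) → ∃ v, bd v = x) :
    Nonempty (singularHomologyQ (TopCat.of Y) p ≅ singularHomologyQ (TopCat.of X) p) := by
  have hc (Z : Type) [TopologicalSpace Z] (x : (singularChainComplexQ (TopCat.of Z)).X p) :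
      (singularChainComplexQ (TopCat.of Z)).d p (p - 1) x = 0 ↔ IsCycle (chainEquiv Z p x) := by
    cases p with
    | zero =>
      refine iff_of_true ?_ trivial
      rw [HomologicalComplex.shape _ _ _ (by simp)]
      rfl
    | succ p =>
      change _ ↔ bd _ = 0
      rw [← chainEquiv_d, LinearEquiv.map_eq_zero_iff]
      rfl
  have := isIso_homologyMap (chainComplexMap f) (i := p + 1) (j := p) (k := p - 1)
    (by simp) (by cases p <;> simp) ?_ ?_
  · exact ⟨(asIso (HomologicalComplex.homologyMap (chainComplexMap f) p)).symm⟩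
  · intro y hy
    obtain ⟨x, hx, w, hw⟩ := hsurj _ ((hc Y y).1 hy)
    refine ⟨(chainEquiv X p).symm x, (hc X _).2 (by simpa using hx),
      (chainEquiv Y (p + 1)).symm w, (chainEquiv Y p).injective ?_⟩
    rw [chainEquiv_d, map_sub]
    erw [chainEquiv_map]
    simpa using hw
  · rintro x hx ⟨w, hw⟩
    obtain ⟨v, hv⟩ := hinj _ ((hc X x).1 hx) ⟨chainEquiv Y (p + 1) w, by
      rw [← chainEquiv_d, hw]
      exact chainEquiv_map f x⟩
    refine ⟨(chainEquiv X (p + 1)).symm v, (chainEquiv X p).injective ?_⟩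
    rw [chainEquiv_d]
    simpa using hv

/-- Homotopic maps have the same effect on cycles up to boundaries. -/
lemma IsCycle.exists_bd_eq_of_homotopy {p : ℕ} {f g : C(X, Y)} (H : f.Homotopy g)
    {z : Chain p X} (hz : IsCycle z) : ∃ w, bd w = RatChain.push f z - RatChain.push g z := by
  let h : Homotopy (chainComplexMap f) (chainComplexMap g) :=
    (((TopCat.Homotopy.toSSet (X := TopCat.of X) (Y := TopCat.of Y)
    (f := TopCat.ofHom f) (g := TopCat.ofHom g) H).toSimplicialObjectHomotopy).whiskerRight
      (ModuleCat.free ℚ)).toChainHomotopy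
  have hcomm : (chainComplexMap f).f p ((chainEquiv X p).symm z) =
      (dNext p h.hom + prevD p h.hom + (chainComplexMap g).f p) ((chainEquiv X p).symm z) :=
    ConcreteCategory.congr_hom (h.comm p) ((chainEquiv X p).symm z)
  have hd : (dNext p h.hom) ((chainEquiv X p).symm z) = 0 := by
    cases p with
    | zero =>
      rw [dNext_eq_zero _ _ (by simp)]
      rfl
    | succ p =>
      rw [dNext_eq h.hom (show (ComplexShape.down ℕ).Rel (p + 1) p by simp)]
      have : (singularChainComplexQ (TopCat.of X)).d (p + 1) p
          ((chainEquiv X (p + 1)).symm z) = 0 := by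
        apply (chainEquiv X p).injective
        rw [chainEquiv_d]
        simpa using (show bd z = 0 from hz)
      exact (congrArg (h.hom p (p + 1)) this).trans (map_zero _)
  have hp : (prevD p h.hom) ((chainEquiv X p).symm z) =
      (singularChainComplexQ (TopCat.of Y)).d (p + 1) p
        (h.hom p (p + 1) ((chainEquiv X p).symm z)) := by
    rw [prevD_eq h.hom (show (ComplexShape.down ℕ).Rel (p + 1) p by simp)]
    rfl
  have key : (chainComplexMap f).f p ((chainEquiv X p).symm z) =
      (singularChainComplexQ (TopCat.of Y)).d (p + 1) p
        (h.hom p (p + 1) ((chainEquiv X p).symm z)) +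
      (chainComplexMap g).f p ((chainEquiv X p).symm z) := by
    refine hcomm.trans ?_
    change (dNext p h.hom) ((chainEquiv X p).symm z) +
      (prevD p h.hom) ((chainEquiv X p).symm z) + _ = _
    rw [hd, hp, zero_add]
  have hf (k : C(X, Y)) : chainEquiv Y p ((chainComplexMap k).f p ((chainEquiv X p).symm z)) =
      RatChain.push k z := by
    refine (chainEquiv_map k _).trans ?_
    rw [LinearEquiv.apply_symm_apply]
  refine ⟨chainEquiv Y (p + 1) (h.hom p (p + 1) ((chainEquiv X p).symm z)), ?_⟩
  rw [← hf f, ← hf g, key, map_add, chainEquiv_d, add_sub_cancel_right]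

section TotallyDisconnected

variable [TotallyDisconnectedSpace X]

lemma simplex_eq_const {p : ℕ} (σ : Simplex p X) :
    σ = ContinuousMap.const _ (σ (vertices p 0)) := by
  have : PreconnectedSpace (stdSimplex ℝ (Fin (p + 1))) :=
    Subtype.preconnectedSpace (convex_stdSimplex ℝ _).isPreconnected
  ext t
  exact (isPreconnected_range σ.continuous).subsingleton ⟨t, rfl⟩ ⟨_, rfl⟩

lemma face_eq_const {p : ℕ} (i : Fin (p + 2)) (σ : Simplex (p + 1) X) :
    face p i σ = ContinuousMap.const _ (σ (vertices (p + 1) 0)) := by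
  conv_lhs => rw [simplex_eq_const σ]
  rfl

lemma bd_single_eq_of_totallyDisconnected {p : ℕ} (σ : Simplex (p + 1) X) :
    bd (single σ 1) = (if Even p then 0 else (1 : ℚ)) •
      single (ContinuousMap.const _ (σ (vertices (p + 1) 0)) : Simplex p X) (1 : ℚ) := by
  rw [bd_single, one_smul]
  simp only [face_eq_const]
  rw [← single_finsetSum, Fin.sum_neg_one_pow, smul_single]
  simp [Nat.even_add]

/-- In a totally disconnected space all cycles of positive degree are boundaries. -/
lemma exists_bd_eq_of_totallyDisconnected {p : ℕ} (z : Chain (p + 1) X) (hz : bd z = 0) :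
    ∃ w, bd w = z := by
  let ext (q r : ℕ) : Chain q X →ₗ[ℚ] Chain r X :=
    lmapDomain ℚ ℚ fun σ ↦ ContinuousMap.const _ (σ (vertices q 0))
  by_cases hp : Even p
  · refine ⟨ext (p + 1) (p + 2) z, ?_⟩
    suffices bd ∘ₗ ext (p + 1) (p + 2) = LinearMap.id from LinearMap.congr_fun this z
    ext1 σ
    ext1
    simp [ext, mapDomain_single, bd_single_eq_of_totallyDisconnected, Nat.even_add, hp,
      ← simplex_eq_const]
  · have : ext p (p + 1) (bd z) = z := by
      suffices ext p (p + 1) ∘ₗ bd = LinearMap.id from LinearMap.congr_fun this z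
      ext1 σ
      ext1
      simp [ext, mapDomain_single, bd_single_eq_of_totallyDisconnected, hp,
        ← simplex_eq_const]
    exact ⟨0, by rw [← this, hz, map_zero, map_zero]⟩

end TotallyDisconnected

/-- Cycles of positive degree are boundaries in a space which deforms into a totally
disconnected space. -/
lemma exists_bd_eq_of_homotopy {D : Type} [TopologicalSpace D] [TotallyDisconnectedSpace D]
    (r : C(X, D)) (s : C(D, X)) (H : (ContinuousMap.id X).Homotopy (s.comp r)) {p : ℕ}
    (z : Chain (p + 1) X) (hz : bd z = 0) : ∃ w, bd w = z := by
  obtain ⟨w, hw⟩ := IsCycle.exists_bd_eq_of_homotopy H (z := z) hz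
  obtain ⟨v, hv⟩ := exists_bd_eq_of_totallyDisconnected (push r z)
    (by rw [bd_push, hz, map_zero])
  refine ⟨w + push s v, ?_⟩
  rw [map_add, hw, bd_push, hv, push_push, push_id, sub_add_cancel]

/-- Cycles of positive degree within a subset bound within the subset if the subset deforms into
a totally disconnected space. -/
lemma exists_mem_within_bd_eq {D : Type} [TopologicalSpace D] [TotallyDisconnectedSpace D]
    {A : Set X} (r : C(A, D)) (s : C(D, A)) (H : (ContinuousMap.id A).Homotopy (s.comp r)) {p : ℕ}
    {z : Chain (p + 1) X} (hz : z ∈ within (p + 1) A) (hz' : bd z = 0) :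
    ∃ w ∈ within (p + 2) A, bd w = z := by
  obtain ⟨y, rfl⟩ := exists_push_subtype hz
  rw [bd_push] at hz'
  obtain ⟨w, hw⟩ := exists_bd_eq_of_homotopy r s H y
    (push_injective Subtype.val_injective (hz'.trans (map_zero _).symm))
  exact ⟨_, push_subtype_mem_within w, by rw [bd_push, hw]⟩

section Carrier

variable {Y Z : Type} [TopologicalSpace Y] [TopologicalSpace Z]

open Classical in
/-- A chain within `A` with a prescribed boundary, if there is one. -/
def fill {q : ℕ} (A : Set Z) (y : Chain q Z) : Chain (q + 1) Z :=
  if h : ∃ w ∈ within (q + 1) A, bd w = y then h.choose else 0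

lemma fill_mem_within {q : ℕ} (A : Set Z) (y : Chain q Z) : fill A y ∈ within (q + 1) A := by
  unfold fill
  split_ifs with h
  · exact h.choose_spec.1
  · exact zero_mem _

lemma bd_fill {q : ℕ} {A : Set Z} {y : Chain q Z} (h : ∃ w ∈ within (q + 1) A, bd w = y) :
    bd (fill A y) = y := by
  rw [fill, dif_pos h]
  exact h.choose_spec.2

/-- The cycles of degree `q + 1` within `A` bound within `A`. -/
def BoundsCycles (A : Set Z) (q : ℕ) : Prop :=
  ∀ z ∈ within (q + 1) A, bd z = 0 → ∃ w ∈ within (q + 2) A, bd w = z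

variable (S : ∀ q, Set (Simplex q Y)) (C : ∀ q, Simplex q Y → Set Z)

/-- The extension of a map in degree `0` to a map of chains carried by `C`. -/
def carriedMap (τ : Chain 0 Y →ₗ[ℚ] Chain 0 Z) : ∀ q, Chain q Y →ₗ[ℚ] Chain q Z
  | 0 => τ
  | q + 1 => linearCombination ℚ fun σ ↦ fill (C (q + 1) σ) (carriedMap τ q (bd (single σ 1)))

/-- The null-homotopy, carried by `C`, of a map of chains carried by `C`. -/
def carriedHomotopy (f : ∀ q, Chain q Y →ₗ[ℚ] Chain q Z) : ∀ q, Chain q Y →ₗ[ℚ] Chain (q + 1) Z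
  | 0 => 0
  | q + 1 => linearCombination ℚ fun σ ↦
      fill (C (q + 1) σ) (f (q + 1) (single σ 1) - carriedHomotopy f q (bd (single σ 1)))

lemma carriedMap_succ_single (τ : Chain 0 Y →ₗ[ℚ] Chain 0 Z) (q : ℕ) (σ : Simplex (q + 1) Y) :
    carriedMap C τ (q + 1) (single σ 1) =
      fill (C (q + 1) σ) (carriedMap C τ q (bd (single σ 1))) := by
  simp [carriedMap]

lemma carriedHomotopy_succ_single (f : ∀ q, Chain q Y →ₗ[ℚ] Chain q Z) (q : ℕ)
    (σ : Simplex (q + 1) Y) : carriedHomotopy C f (q + 1) (single σ 1) =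
      fill (C (q + 1) σ) (f (q + 1) (single σ 1) - carriedHomotopy C f q (bd (single σ 1))) := by
  simp [carriedHomotopy]

variable {S C}

lemma map_bd_single_mem {q : ℕ} {M : Type} [AddCommGroup M] [Module ℚ M]
    (f : Chain q Y →ₗ[ℚ] M) (N : Submodule ℚ M) (σ : Simplex (q + 1) Y)
    (h : ∀ i, f (single (face q i σ) 1) ∈ N) : f (bd (single σ 1)) ∈ N :=
  bd_single_mem (N := N.comap f) σ h 1

lemma bd_single_mem_supported (hS : ∀ q, ∀ σ ∈ S (q + 1), ∀ i, face q i σ ∈ S q) {q : ℕ}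
    {σ : Simplex (q + 1) Y} (hσ : σ ∈ S (q + 1)) : bd (single σ 1) ∈ supported ℚ ℚ (S q) :=
  bd_single_mem σ (fun i ↦ single_mem_supported ℚ _ (hS q σ hσ i)) 1

lemma carriedMap_mem {τ : Chain 0 Y →ₗ[ℚ] Chain 0 Z}
    (h0 : ∀ σ ∈ S 0, τ (single σ 1) ∈ within 0 (C 0 σ)) : ∀ (q : ℕ) (σ : Simplex q Y), σ ∈ S q →
    carriedMap C τ q (single σ 1) ∈ within q (C q σ)
  | 0, σ, hσ => h0 σ hσ
  | q + 1, σ, hσ => by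
    rw [carriedMap_succ_single]
    exact fill_mem_within _ _

lemma carriedHomotopy_mem (f : ∀ q, Chain q Y →ₗ[ℚ] Chain q Z) :
    ∀ (q : ℕ) (σ : Simplex q Y), carriedHomotopy C f q (single σ 1) ∈ within (q + 1) (C q σ)
  | 0, σ => zero_mem _
  | q + 1, σ => by
    rw [carriedHomotopy_succ_single]
    exact fill_mem_within _ _

section

variable (hS : ∀ q, ∀ σ ∈ S (q + 1), ∀ i, face q i σ ∈ S q)
  (hC : ∀ q, ∀ σ ∈ S (q + 1), ∀ i, C q (face q i σ) ⊆ C (q + 1) σ)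

include hS hC

lemma bd_carriedMap {τ : Chain 0 Y →ₗ[ℚ] Chain 0 Z}
    (h0 : ∀ σ ∈ S 0, τ (single σ 1) ∈ within 0 (C 0 σ))
    (h1 : ∀ σ ∈ S 1, ∃ w ∈ within 1 (C 1 σ), bd w = τ (bd (single σ 1)))
    (hq : ∀ q, ∀ σ ∈ S (q + 2), BoundsCycles (C (q + 2) σ) q) {q : ℕ} {z : Chain (q + 1) Y}
    (hz : z ∈ supported ℚ ℚ (S (q + 1))) :
    bd (carriedMap C τ (q + 1) z) = carriedMap C τ q (bd z) := by
  induction q with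
  | zero =>
    refine eqOn_supported (bd ∘ₗ carriedMap C τ 1) (carriedMap C τ 0 ∘ₗ bd) (fun σ hσ ↦ ?_) hz
    simp only [LinearMap.comp_apply, carriedMap_succ_single]
    exact bd_fill (h1 σ hσ)
  | succ q ih =>
    refine eqOn_supported (bd ∘ₗ carriedMap C τ (q + 2)) (carriedMap C τ (q + 1) ∘ₗ bd)
      (fun σ hσ ↦ ?_) hz
    simp only [LinearMap.comp_apply]
    rw [carriedMap_succ_single]
    refine bd_fill (hq q σ hσ _ (map_bd_single_mem _ _ σ fun i ↦ ?_) ?_)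
    · exact within_mono (hC _ σ hσ i) (carriedMap_mem h0 _ _ (hS _ σ hσ i))
    · rw [ih (bd_single_mem_supported hS hσ), bd_bd, map_zero]

lemma bd_carriedHomotopy {f : ∀ q, Chain q Y →ₗ[ℚ] Chain q Z}
    (h0 : ∀ σ ∈ S 0, f 0 (single σ 1) = 0)
    (hf : ∀ q, ∀ σ ∈ S q, f q (single σ 1) ∈ within q (C q σ))
    (hf' : ∀ q, ∀ z ∈ supported ℚ ℚ (S (q + 1)), bd (f (q + 1) z) = f q (bd z))
    (hq : ∀ q, ∀ σ ∈ S (q + 1), BoundsCycles (C (q + 1) σ) q) {q : ℕ} {z : Chain (q + 1) Y}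
    (hz : z ∈ supported ℚ ℚ (S (q + 1))) :
    bd (carriedHomotopy C f (q + 1) z) = f (q + 1) z - carriedHomotopy C f q (bd z) := by
  have hf0 {z : Chain 0 Y} (hz : z ∈ supported ℚ ℚ (S 0)) : f 0 z = 0 :=
    eqOn_supported (f 0) 0 (by simpa using h0) hz
  induction q with
  | zero =>
    refine eqOn_supported (bd ∘ₗ carriedHomotopy C f 1)
      (f 1 - carriedHomotopy C f 0 ∘ₗ bd) (fun σ hσ ↦ ?_) hz
    simp only [LinearMap.comp_apply, LinearMap.sub_apply]
    rw [carriedHomotopy_succ_single]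
    refine bd_fill (hq 0 σ hσ _ ?_ ?_)
    · simpa [carriedHomotopy] using hf 1 σ hσ
    · simp only [carriedHomotopy, LinearMap.zero_apply, sub_zero]
      rw [hf' 0 _ (single_mem_supported ℚ _ hσ), hf0 (bd_single_mem_supported hS hσ)]
  | succ q ih =>
    refine eqOn_supported (bd ∘ₗ carriedHomotopy C f (q + 2))
      (f (q + 2) - carriedHomotopy C f (q + 1) ∘ₗ bd) (fun σ hσ ↦ ?_) hz
    simp only [LinearMap.comp_apply, LinearMap.sub_apply]
    rw [carriedHomotopy_succ_single]
    refine bd_fill (hq _ σ hσ _ (sub_mem (hf _ σ hσ) ?_) ?_)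
    · exact map_bd_single_mem _ _ σ fun i ↦
        within_mono (hC _ σ hσ i) (carriedHomotopy_mem f _ _)
    · rw [map_sub, ih (bd_single_mem_supported hS hσ), bd_bd, map_zero, sub_zero,
        hf' _ _ (single_mem_supported ℚ _ hσ), sub_self]

/-- A map of chains carried by acyclic carriers which vanishes in degree `0` sends cycles to
boundaries. -/
lemma exists_bd_eq_of_carrier {f : ∀ q, Chain q Y →ₗ[ℚ] Chain q Z}
    (h0 : ∀ σ ∈ S 0, f 0 (single σ 1) = 0)
    (hf : ∀ q, ∀ σ ∈ S q, f q (single σ 1) ∈ within q (C q σ))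
    (hf' : ∀ q, ∀ z ∈ supported ℚ ℚ (S (q + 1)), bd (f (q + 1) z) = f q (bd z))
    (hq : ∀ q, ∀ σ ∈ S (q + 1), BoundsCycles (C (q + 1) σ) q) {q : ℕ} {z : Chain q Y}
    (hz : z ∈ supported ℚ ℚ (S q)) (hz' : IsCycle z) : ∃ w, bd w = f q z := by
  cases q with
  | zero => exact ⟨0, by rw [map_zero, eqOn_supported (f 0) 0 (by simpa using h0) hz]; rfl⟩
  | succ q =>
    refine ⟨carriedHomotopy C f (q + 1) z, ?_⟩
    rw [bd_carriedHomotopy hS hC h0 hf hf' hq hz, show bd z = 0 from hz', map_zero, sub_zero]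

end

end Carrier

section Transfer

variable {X Y : Type} [TopologicalSpace X] [TopologicalSpace Y] {Γ : Type} [Fintype Γ]

/-- The constant `0`-simplex at a point. -/
def point (x : X) : Simplex 0 X := ContinuousMap.const _ x

lemma eq_point (σ : Simplex 0 X) : σ = point (σ (vertices 0 0)) := by
  have : Subsingleton (stdSimplex ℝ (Fin (0 + 1))) := inferInstanceAs
    (Subsingleton (stdSimplex ℝ (Fin 1)))
  ext t
  rw [Subsingleton.elim t (vertices 0 0)]
  rfl

lemma exists_bd_single_one (σ : Simplex 1 X) : ∃ x ∈ Set.range σ, ∃ y ∈ Set.range σ,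
    bd (single σ 1) = single (point x) 1 - single (point y) 1 := by
  refine ⟨face 0 0 σ (vertices 0 0), range_face_subset _ _ _ ⟨_, rfl⟩,
    face 0 1 σ (vertices 0 0), range_face_subset _ _ _ ⟨_, rfl⟩, ?_⟩
  rw [bd_single, ← eq_point, ← eq_point, Fin.sum_univ_succ, Fin.sum_univ_succ, Fin.sum_univ_zero]
  simp [sub_eq_add_neg]

/-- The sum over a finite group of the maps induced on chains. -/
def norm (act : Γ → C(X, X)) (q : ℕ) : Chain q X →ₗ[ℚ] Chain q X := ∑ g, push (act g)

lemma norm_apply (act : Γ → C(X, X)) {q : ℕ} (z : Chain q X) :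
    norm act q z = ∑ g, push (act g) z := by
  simp [norm]

lemma bd_norm (act : Γ → C(X, X)) {q : ℕ} (z : Chain (q + 1) X) :
    bd (norm act (q + 1) z) = norm act q (bd z) := by
  simp [norm_apply, bd_push]

lemma norm_mem_within {act : Γ → C(X, X)} {A : Set X} (hA : ∀ g, Set.MapsTo (act g) A A) {q : ℕ}
    {z : Chain q X} (hz : z ∈ within q A) : norm act q z ∈ within q A := by
  rw [norm_apply]
  exact sum_mem fun g _ ↦ push_mem_within (hA g) hz

lemma norm_push [Group Γ] {act : Γ → C(X, X)} (hact : ∀ g h, act (g * h) = (act g).comp (act h))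
    (g : Γ)
    {q : ℕ} (z : Chain q X) : norm act q (push (act g) z) = norm act q z := by
  simp only [norm_apply, push_push, ← hact]
  exact Fintype.sum_equiv (Equiv.mulRight g) _ _ fun _ ↦ rfl

lemma push_norm {act : Γ → C(X, X)} {π : C(X, Y)} (hπ : ∀ g, π.comp (act g) = π) {q : ℕ}
    (z : Chain q X) : push π (norm act q z) = (Fintype.card Γ : ℚ) • push π z := by
  simp [norm_apply, push_push, hπ, Nat.cast_smul_eq_nsmul]

variable {act : Γ → C(X, X)} {π : C(X, Y)} {S : ∀ q, Set (Simplex q Y)}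
  {Φ : ∀ q, Simplex q Y → Set Y}

/-- The transfer for the quotient by a finite group, constructed from acyclic carriers. -/
theorem exists_transfer [Group Γ]
    (hact : ∀ g h, act (g * h) = (act g).comp (act h)) (hπ : ∀ g, π.comp (act g) = π)
    (hsurj : Function.Surjective π) (horb : ∀ x x', π x = π x' → ∃ g, act g x = x')
    (hS : ∀ q, ∀ σ ∈ S (q + 1), ∀ i, face q i σ ∈ S q)
    (hΦ : ∀ q, ∀ σ ∈ S (q + 1), ∀ i, Φ q (face q i σ) ⊆ Φ (q + 1) σ)
    (hΦ' : ∀ q, ∀ σ ∈ S q, Set.range σ ⊆ Φ q σ)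
    (hY : ∀ q, ∀ σ ∈ S q, ∀ r, BoundsCycles (Φ q σ) r)
    (hX : ∀ q, ∀ σ ∈ S q, ∀ r, BoundsCycles (π ⁻¹' Φ q σ) r)
    (hX' : ∀ q, ∀ σ ∈ S q, ∀ x ∈ π ⁻¹' Φ q σ, ∀ y ∈ π ⁻¹' Φ q σ,
      ∃ w ∈ within 1 (π ⁻¹' Φ q σ),
        bd w = norm act 0 (single (point x) 1) - norm act 0 (single (point y) 1)) :
    ∃ τ : ∀ q, Chain q Y →ₗ[ℚ] Chain q X,
      (∀ q, ∀ z ∈ supported ℚ ℚ (S (q + 1)), bd (τ (q + 1) z) = τ q (bd z)) ∧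
      (∀ q, ∀ z ∈ supported ℚ ℚ (S q), IsCycle z →
        ∃ w, bd w = push π (τ q z) - (Fintype.card Γ : ℚ) • z) ∧
      (∀ q, ∀ z ∈ supported ℚ ℚ {σ : Simplex q X | π.comp σ ∈ S q}, IsCycle z →
        ∃ w, bd w = τ q (push π z) - norm act q z) := by
  have hmaps (A : Set Y) (g : Γ) : Set.MapsTo (act g) (π ⁻¹' A) (π ⁻¹' A) := fun x hx ↦ by
    have : π (act g x) = π x := ContinuousMap.congr_fun (hπ g) x
    rwa [Set.mem_preimage, this]
  choose l hl using hsurj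
  let τ₀ : Chain 0 Y →ₗ[ℚ] Chain 0 X := linearCombination ℚ fun σ ↦
    norm act 0 (single (point (l (σ (vertices 0 0)))) 1)
  have hτ₀ (y : Y) : τ₀ (single (point y) 1) = norm act 0 (single (point (l y)) 1) := by
    simp only [τ₀, linearCombination_single, one_smul]
    rfl
  have hpt {A : Set X} {x : X} (hx : x ∈ A) : single (point x) (1 : ℚ) ∈ within 0 A := by
    refine single_mem_within ?_ _
    rintro _ ⟨t, rfl⟩
    exact hx
  have h0 : ∀ σ ∈ S 0, τ₀ (single σ 1) ∈ within 0 (π ⁻¹' Φ 0 σ) := fun σ hσ ↦ by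
    rw [show single σ (1 : ℚ) = single (point (σ (vertices 0 0))) 1 by rw [← eq_point], hτ₀]
    refine norm_mem_within (hmaps _) (hpt ?_)
    rw [Set.mem_preimage, hl]
    exact hΦ' 0 σ hσ ⟨_, rfl⟩
  have h1 : ∀ σ ∈ S 1, ∃ w ∈ within 1 (π ⁻¹' Φ 1 σ), bd w = τ₀ (bd (single σ 1)) := fun σ hσ ↦ by
    obtain ⟨x, hx, y, hy, h⟩ := exists_bd_single_one σ
    rw [h, map_sub, hτ₀, hτ₀]
    refine hX' 1 σ hσ _ ?_ _ ?_
    · rw [Set.mem_preimage, hl]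
      exact hΦ' 1 σ hσ hx
    · rw [Set.mem_preimage, hl]
      exact hΦ' 1 σ hσ hy
  have hΦX : ∀ q, ∀ σ ∈ S (q + 1), ∀ i, π ⁻¹' Φ q (face q i σ) ⊆ π ⁻¹' Φ (q + 1) σ :=
    fun q σ hσ i ↦ Set.preimage_mono (hΦ q σ hσ i)
  let C : ∀ q, Simplex q Y → Set X := fun q σ ↦ π ⁻¹' Φ q σ
  have hmem := carriedMap_mem (C := C) h0
  have hbd : ∀ q, ∀ z ∈ supported ℚ ℚ (S (q + 1)),
      bd (carriedMap C τ₀ (q + 1) z) = carriedMap C τ₀ q (bd z) := fun q z hz ↦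
    bd_carriedMap hS hΦX h0 h1 (fun q σ hσ ↦ hX _ σ hσ q) hz
  refine ⟨carriedMap C τ₀, hbd, fun q z hz hz' ↦ ?_, fun q z hz hz' ↦ ?_⟩
  · refine exists_bd_eq_of_carrier hS hΦ
      (f := fun q ↦ push π ∘ₗ carriedMap C τ₀ q - (Fintype.card Γ : ℚ) • LinearMap.id)
      (fun σ hσ ↦ ?_) (fun q σ hσ ↦ ?_) (fun q z hz ↦ ?_) (fun q σ hσ ↦ hY _ σ hσ q) hz hz'
    · rw [eq_point σ]
      change push π (τ₀ _) - (Fintype.card Γ : ℚ) • single _ 1 = 0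
      rw [hτ₀, push_norm hπ, push_single, sub_eq_zero]
      congr 2
      ext t
      exact hl _
    · refine sub_mem (push_mem_within (A := C q σ) (fun _ h ↦ h) (hmem q σ hσ))
        (Submodule.smul_mem _ _ (single_mem_within (hΦ' q σ hσ) _))
    · simp only [LinearMap.sub_apply, LinearMap.comp_apply, LinearMap.smul_apply,
        LinearMap.id_apply, map_sub, map_smul, bd_push, hbd q z hz]
  · have hpush : ∀ q, ∀ z ∈ supported ℚ ℚ {σ : Simplex q X | π.comp σ ∈ S q},
        push π z ∈ supported ℚ ℚ (S q) := fun q z hz ↦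
      map_mem_of_supported _ (fun σ hσ ↦ by
        rw [push_single]
        exact single_mem_supported ℚ _ hσ) hz
    refine exists_bd_eq_of_carrier (S := fun q ↦ {σ : Simplex q X | π.comp σ ∈ S q})
      (C := fun q σ ↦ π ⁻¹' Φ q (π.comp σ)) (fun q σ hσ i ↦ hS q _ hσ i)
      (fun q σ hσ i ↦ hΦX q _ hσ i) (f := fun q ↦ carriedMap C τ₀ q ∘ₗ push π - norm act q)
      (fun σ hσ ↦ ?_) (fun q σ hσ ↦ ?_) (fun q z hz ↦ ?_) (fun q σ hσ ↦ hX _ _ hσ q) hz hz'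
    · rw [eq_point σ]
      set x := σ (vertices 0 0)
      rw [LinearMap.sub_apply, LinearMap.comp_apply, push_single]
      change τ₀ (single (point (π x)) 1) - _ = 0
      obtain ⟨g, hg⟩ := horb (l (π x)) x (hl _)
      have hgx : (act g).comp (point (l (π x))) = point x := ContinuousMap.ext fun _ ↦ hg
      rw [hτ₀, sub_eq_zero, ← norm_push hact g, push_single, hgx]
    · refine sub_mem ?_ (norm_mem_within (hmaps _) (single_mem_within ?_ _))
      · rw [LinearMap.comp_apply, push_single]
        exact hmem q _ hσ
      · rintro _ ⟨t, rfl⟩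
        exact hΦ' q _ hσ ⟨t, rfl⟩
    · simp only [LinearMap.sub_apply, LinearMap.comp_apply, map_sub, ← bd_push,
        hbd q _ (hpush _ z hz), bd_norm]

end Transfer

section Criterion

variable {X Y : Type} [TopologicalSpace X] [TopologicalSpace Y]

/-- A finite family of increasing sequences of sets, indexed together with radii, such that a member
of smaller radius is contained in the next stage of each larger member which it meets. -/
structure GradedCover (Y : Type) [TopologicalSpace Y] where
  /-- The indices. -/
  ι : Type
  finite : Finite ι
  /-- The radius of a member. -/
  radius : ι → ℝ
  /-- The stages of a member. -/
  stage : ℕ → ι → Set Y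
  isOpen_stage : ∀ i, IsOpen (stage 0 i)
  iUnion_stage : ⋃ i, stage 0 i = Set.univ
  stage_subset : ∀ q i j, radius j ≤ radius i → (stage 0 i ∩ stage 0 j).Nonempty →
    stage q j ⊆ stage (q + 1) i

namespace GradedCover

variable (𝒰 : GradedCover Y)

lemma stage_zero_subset (q : ℕ) {i : 𝒰.ι} (hi : (𝒰.stage 0 i).Nonempty) :
    𝒰.stage 0 i ⊆ 𝒰.stage q i := by
  induction q with
  | zero => exact subset_rfl
  | succ q ih => exact ih.trans (𝒰.stage_subset q i i le_rfl (by simpa using hi))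

lemma exists_minimal {A : Set Y} (hA : ∃ i, A ⊆ 𝒰.stage 0 i) :
    ∃ i, A ⊆ 𝒰.stage 0 i ∧ ∀ j, A ⊆ 𝒰.stage 0 j → 𝒰.radius i ≤ 𝒰.radius j := by
  have := 𝒰.finite
  exact Set.exists_min_image {i | A ⊆ 𝒰.stage 0 i} 𝒰.radius (Set.toFinite _) hA

open Classical in
/-- The `q`-th stage of a member of smallest radius containing a given set. -/
def carrier (q : ℕ) (A : Set Y) : Set Y :=
  if h : ∃ i, A ⊆ 𝒰.stage 0 i then 𝒰.stage q (𝒰.exists_minimal h).choose else ∅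

lemma exists_carrier_eq {A : Set Y} (hA : ∃ i, A ⊆ 𝒰.stage 0 i) : ∃ i, A ⊆ 𝒰.stage 0 i ∧
    (∀ j, A ⊆ 𝒰.stage 0 j → 𝒰.radius i ≤ 𝒰.radius j) ∧ ∀ q, 𝒰.carrier q A = 𝒰.stage q i :=
  ⟨_, (𝒰.exists_minimal hA).choose_spec.1, (𝒰.exists_minimal hA).choose_spec.2, fun q ↦ by
    rw [carrier, dif_pos hA]⟩

lemma carrier_subset {A B : Set Y} (hA : A.Nonempty) (hAB : A ⊆ B) (hB : ∃ i, B ⊆ 𝒰.stage 0 i)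
    (q : ℕ) : 𝒰.carrier q A ⊆ 𝒰.carrier (q + 1) B := by
  obtain ⟨i, hi, -, hi'⟩ := 𝒰.exists_carrier_eq hB
  obtain ⟨j, hj, hj', hj''⟩ := 𝒰.exists_carrier_eq (hB.imp fun i ↦ hAB.trans)
  rw [hi', hj'']
  exact 𝒰.stage_subset q i j (hj' i (hAB.trans hi))
    (hA.mono (Set.subset_inter (hAB.trans hi) hj))

lemma subset_carrier {A : Set Y} (hA : A.Nonempty) (hA' : ∃ i, A ⊆ 𝒰.stage 0 i) (q : ℕ) :
    A ⊆ 𝒰.carrier q A := by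
  obtain ⟨i, hi, -, hi'⟩ := 𝒰.exists_carrier_eq hA'
  rw [hi']
  exact hi.trans (𝒰.stage_zero_subset q (hA.mono hi))

end GradedCover

/-- The quotient map by a finite group whose elements act trivially on rational homology induces an
isomorphism on rational homology, provided that there are sufficiently good covers. -/
theorem nonempty_singularHomologyQ_iso_of_gradedCover {Γ : Type} [Fintype Γ] [Group Γ]
    {act : Γ → C(X, X)} {π : C(X, Y)} (p : ℕ) (𝒰 : GradedCover Y)
    (hact : ∀ g h, act (g * h) = (act g).comp (act h)) (hπ : ∀ g, π.comp (act g) = π)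
    (hsurj : Function.Surjective π) (horb : ∀ x x', π x = π x' → ∃ g, act g x = x')
    (hY : ∀ q ≤ p + 1, ∀ i r, BoundsCycles (𝒰.stage q i) r)
    (hX : ∀ q ≤ p + 1, ∀ i r, BoundsCycles (π ⁻¹' 𝒰.stage q i) r)
    (hX' : ∀ q ≤ p + 1, ∀ i, ∀ x ∈ π ⁻¹' 𝒰.stage q i, ∀ y ∈ π ⁻¹' 𝒰.stage q i,
      ∃ w ∈ within 1 (π ⁻¹' 𝒰.stage q i),
        bd w = norm act 0 (single (point x) 1) - norm act 0 (single (point y) 1))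
    (htriv : ∀ g, ∀ z : Chain p X, IsCycle z → ∃ v, bd v = push (act g) z - z) :
    Nonempty (singularHomologyQ (TopCat.of Y) p ≅ singularHomologyQ (TopCat.of X) p) := by
  have hne {Z : Type} [TopologicalSpace Z] {q : ℕ} (σ : Simplex q Z) : (Set.range σ).Nonempty :=
    ⟨_, vertices q 0, rfl⟩
  have hcard : (Fintype.card Γ : ℚ) ≠ 0 := by simp
  let S : ∀ q, Set (Simplex q Y) := fun q ↦ {σ | q ≤ p + 1 ∧ ∃ i, Set.range σ ⊆ 𝒰.stage 0 i}
  have hΦ {P : Set Y → Prop} (q : ℕ) (hP : ∀ i, P (𝒰.stage q i)) (σ : Simplex q Y)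
      (hσ : σ ∈ S q) : P (𝒰.carrier q (Set.range σ)) := by
    obtain ⟨i, -, -, hi⟩ := 𝒰.exists_carrier_eq hσ.2
    rw [hi]
    exact hP i
  obtain ⟨τ, hτ, hτ₁, hτ₂⟩ := exists_transfer (S := S) (Φ := fun q σ ↦ 𝒰.carrier q (Set.range σ))
    hact hπ hsurj horb
    (fun q σ hσ i ↦ ⟨by have := hσ.1; lia, hσ.2.imp fun _ ↦ (range_face_subset _ _ _).trans⟩)
    (fun q σ hσ i ↦ 𝒰.carrier_subset (hne _) (range_face_subset _ _ _) hσ.2 q)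
    (fun q σ hσ ↦ 𝒰.subset_carrier (hne σ) hσ.2 q)
    (fun q σ hσ ↦ hΦ (P := fun A ↦ ∀ r, BoundsCycles A r) q (hY q hσ.1) σ hσ)
    (fun q σ hσ ↦ hΦ (P := fun A ↦ ∀ r, BoundsCycles (π ⁻¹' A) r) q (hX q hσ.1) σ hσ)
    (fun q σ hσ ↦ hΦ (P := fun A ↦ ∀ x ∈ π ⁻¹' A, ∀ y ∈ π ⁻¹' A, ∃ w ∈ within 1 (π ⁻¹' A),
        bd w = norm act 0 (single (point x) 1) - norm act 0 (single (point y) 1))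
      q (hX' q hσ.1) σ hσ)
  have hS {q : ℕ} (hq : q ≤ p + 1) {z : Chain q Y} (hz : z ∈ small q (𝒰.stage 0)) :
      z ∈ supported ℚ ℚ (S q) := supported_mono (t := S q) (fun σ hσ ↦ ⟨hq, hσ⟩) hz
  refine nonempty_singularHomologyQ_iso π p (fun y hy ↦ ?_) (fun x hx ⟨w, hw⟩ ↦ ?_)
  · obtain ⟨y', hy', hcyc, w, hw⟩ := hy.exists_small 𝒰.isOpen_stage 𝒰.iUnion_stage
    obtain ⟨v, hv⟩ := hτ₁ p y' (hS (by lia) hy') hcyc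
    refine ⟨(Fintype.card Γ : ℚ)⁻¹ • τ p y', IsCycle.smul ?_ _,
      w - (Fintype.card Γ : ℚ)⁻¹ • v, ?_⟩
    · cases p with
      | zero => trivial
      | succ p =>
        change bd _ = 0
        rw [hτ p y' (hS (by lia) hy'), show bd y' = 0 from hcyc, map_zero]
    · rw [map_sub, map_smul, hw, hv, map_smul, smul_sub, smul_smul, inv_mul_cancel₀ hcard, one_smul]
      abel
  · obtain ⟨x', hx', hcyc, u, hu⟩ := hx.exists_small (U := fun i ↦ π ⁻¹' 𝒰.stage 0 i)
      (fun i ↦ (𝒰.isOpen_stage i).preimage π.continuous)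
      (by rw [← Set.preimage_iUnion, 𝒰.iUnion_stage, Set.preimage_univ])
    have hrange (σ : Simplex p X) (hσ : ∃ i, Set.range σ ⊆ π ⁻¹' 𝒰.stage 0 i) :
        ∃ i, Set.range (π.comp σ) ⊆ 𝒰.stage 0 i := by
      obtain ⟨i, hi⟩ := hσ
      refine ⟨i, ?_⟩
      rintro _ ⟨t, rfl⟩
      exact hi ⟨t, rfl⟩
    have hpush : push π x' ∈ small p (𝒰.stage 0) :=
      map_mem_of_supported _ (fun σ hσ ↦ by
        rw [push_single]
        exact single_mem_supported ℚ _ (hrange σ hσ)) hx'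
    have hw' : bd (w - push π u) = push π x' := by
      rw [map_sub, hw, bd_push, hu, map_sub]
      abel
    obtain ⟨w', hw₁, hw₂⟩ := exists_small_bd_eq 𝒰.isOpen_stage 𝒰.iUnion_stage (w - push π u)
      (by rwa [hw'])
    obtain ⟨v, hv⟩ := hτ₂ p x' (supported_mono
      (t := {σ : Simplex p X | π.comp σ ∈ S p}) (fun σ hσ ↦ ⟨by lia, hrange σ hσ⟩) hx') hcyc
    choose t ht using fun g ↦ htriv g x' hcyc
    have hnorm : bd (τ (p + 1) w' - v - ∑ g, t g) = (Fintype.card Γ : ℚ) • x' := by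
      simp only [map_sub, map_sum, hτ p w' (hS le_rfl hw₁), hw₂, hw', hv, ht, norm_apply,
        Finset.sum_sub_distrib, Finset.sum_const, Finset.card_univ, Nat.cast_smul_eq_nsmul]
      abel
    refine ⟨(Fintype.card Γ : ℚ)⁻¹ • (τ (p + 1) w' - v - ∑ g, t g) + u, ?_⟩
    rw [map_add, map_smul, hnorm, hu, smul_smul, inv_mul_cancel₀ hcard, one_smul]
    abel

end Criterion

section Sphere

variable {E : Type} [NormedAddCommGroup E] [InnerProductSpace ℝ E]

/-- The map induced on the unit sphere by a linear isometry. -/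
def sphereMap (g : E ≃ₗᵢ[ℝ] E) : C(Metric.sphere (0 : E) 1, Metric.sphere (0 : E) 1) where
  toFun x := ⟨g x, by simp⟩
  continuous_toFun := by fun_prop

@[simp] lemma coe_sphereMap (g : E ≃ₗᵢ[ℝ] E) (x : Metric.sphere (0 : E) 1) :
    (sphereMap g x : E) = g x := rfl

lemma sphereMap_mul (g h : E ≃ₗᵢ[ℝ] E) : sphereMap (g * h) = (sphereMap g).comp (sphereMap h) := rfl

lemma dist_sphereMap (g : E ≃ₗᵢ[ℝ] E) (x y : Metric.sphere (0 : E) 1) :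
    dist (sphereMap g x) (sphereMap g y) = dist x y :=
  g.isometry.dist_eq _ _

/-- The radial projection onto the unit sphere of the line segment from `z` to `c`. -/
def radialSegment (t : ℝ) (z c : E) : E := ‖(1 - t) • z + t • c‖⁻¹ • ((1 - t) • z + t • c)

lemma map_radialSegment (g : E ≃ₗᵢ[ℝ] E) (t : ℝ) (z c : E) :
    g (radialSegment t z c) = radialSegment t (g z) (g c) := by
  simp only [radialSegment, map_smul, map_add, ← g.norm_map ((1 - t) • z + t • c)]

section

variable {z c : E} (hz : ‖z‖ = 1) (hc : ‖c‖ = 1) (hzc : dist z c ≤ 1) {t : ℝ} (ht : 0 ≤ t)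
  (ht' : t ≤ 1)

include hz hc

lemma dist_sq_eq : dist z c ^ 2 = 2 - 2 * inner ℝ z c := by
  rw [dist_eq_norm, norm_sub_sq_real, hz, hc]
  ring

include hzc ht

lemma inner_le_inner_segment : 0 < inner ℝ z c ∧
    inner ℝ z c ≤ inner ℝ ((1 - t) • z + t • c) c := by
  have h := dist_sq_eq hz hc
  have h' : dist z c ^ 2 ≤ 1 := pow_le_one₀ dist_nonneg hzc
  have h'' : (0 : ℝ) ≤ dist z c ^ 2 := by positivity
  refine ⟨by linarith, ?_⟩
  rw [inner_add_left, real_inner_smul_left, real_inner_smul_left, real_inner_self_eq_norm_sq, hc]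
  nlinarith

lemma segment_ne_zero : (1 - t) • z + t • c ≠ 0 := by
  intro h
  have := inner_le_inner_segment hz hc hzc ht
  rw [h, inner_zero_left] at this
  linarith

lemma norm_radialSegment : ‖radialSegment t z c‖ = 1 := by
  rw [radialSegment, norm_smul, norm_inv, norm_norm,
    inv_mul_cancel₀ (norm_ne_zero_iff.2 (segment_ne_zero hz hc hzc ht))]

include ht'

lemma dist_radialSegment_le : dist (radialSegment t z c) c ≤ dist z c := by
  refine le_of_sq_le_sq ?_ dist_nonneg
  rw [dist_sq_eq (norm_radialSegment hz hc hzc ht) hc, dist_sq_eq hz hc, radialSegment,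
    real_inner_smul_left]
  have h := inner_le_inner_segment hz hc hzc ht
  have hn : ‖(1 - t) • z + t • c‖ ≤ 1 := by
    refine (norm_add_le _ _).trans ?_
    rw [norm_smul, norm_smul, hz, hc, Real.norm_of_nonneg ht, Real.norm_of_nonneg (by linarith)]
    linarith
  have hp := norm_pos_iff.2 (segment_ne_zero hz hc hzc ht)
  have := one_le_inv_iff₀.2 ⟨hp, hn⟩
  nlinarith

end

variable {Γ : Type} [Group Γ] (φ : Γ →* (E ≃ₗᵢ[ℝ] E)) (x : Metric.sphere (0 : E) 1)

/-- The points at distance less than `ε` from an orbit. -/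
def nearOrbit (ε : ℝ) : Set (Metric.sphere (0 : E) 1) :=
  {z | ∃ g, dist z (sphereMap (φ g) x) < ε}

/-- Distinct points of an orbit are at distance at least `2 * ε`. -/
def IsSeparated (ε : ℝ) : Prop :=
  ∀ g h, sphereMap (φ g) x ≠ sphereMap (φ h) x →
    2 * ε ≤ dist (sphereMap (φ g) x) (sphereMap (φ h) x)

variable {φ x}

lemma sphereMap_mem_nearOrbit {ε : ℝ} (g : Γ) {z : Metric.sphere (0 : E) 1}
    (hz : z ∈ nearOrbit φ x ε) : sphereMap (φ g) z ∈ nearOrbit φ x ε := by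
  obtain ⟨h, hh⟩ := hz
  refine ⟨g * h, ?_⟩
  rw [map_mul, sphereMap_mul, ContinuousMap.comp_apply, dist_sphereMap]
  exact hh

lemma mem_nearOrbit {ε : ℝ} (hε : 0 < ε) (g : Γ) : sphereMap (φ g) x ∈ nearOrbit φ x ε :=
  ⟨g, by rwa [dist_self]⟩

section

variable {ε : ℝ} (hx : IsSeparated φ x ε)

include hx

lemma eq_of_dist_lt {z : Metric.sphere (0 : E) 1} {g h : Γ} (hg : dist z (sphereMap (φ g) x) < ε)
    (hh : dist z (sphereMap (φ h) x) < ε) : sphereMap (φ g) x = sphereMap (φ h) x := by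
  by_contra hne
  have := hx g h hne
  have := dist_triangle_left (sphereMap (φ g) x) (sphereMap (φ h) x) z
  linarith

/-- The nearest point of a separated orbit is locally constant. -/
lemma exists_center [Finite Γ] : ∃ c : C(nearOrbit φ x ε, Set.range fun g ↦ sphereMap (φ g) x),
    ∀ z, dist z.1 (c z).1 < ε := by
  choose c hc using fun z : nearOrbit φ x ε ↦ z.2
  have : DiscreteTopology (Set.range fun g ↦ sphereMap (φ g) x) := inferInstance
  refine ⟨⟨fun z ↦ ⟨_, c z, rfl⟩, ?_⟩, hc⟩
  rw [continuous_iff_continuousAt]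
  intro z
  refine tendsto_nhds_of_eventually_eq ?_
  have : ∀ᶠ z' : nearOrbit φ x ε in nhds z, dist z'.1 (sphereMap (φ (c z)) x) < ε :=
    (Continuous.dist continuous_subtype_val continuous_const).continuousAt.eventually_lt
      continuousAt_const (hc z)
  filter_upwards [this] with z' hz'
  exact Subtype.ext (eq_of_dist_lt hx (hc z') hz')

/-- A neighbourhood of a separated orbit deforms equivariantly to the orbit. -/
lemma exists_deformation [Finite Γ] (hε : 0 < ε) (hε' : ε ≤ 1) :
    ∃ (r : C(nearOrbit φ x ε, Set.range fun g ↦ sphereMap (φ g) x))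
      (s : C(Set.range fun g ↦ sphereMap (φ g) x, nearOrbit φ x ε))
      (H : (ContinuousMap.id (nearOrbit φ x ε)).Homotopy (s.comp r)),
      (∀ d, (s d).1 = d.1) ∧ ∀ (g : Γ) (t : unitInterval) (z : nearOrbit φ x ε),
        (H (t, ⟨sphereMap (φ g) z, sphereMap_mem_nearOrbit g z.2⟩)).1 =
          sphereMap (φ g) (H (t, z)).1 := by
  obtain ⟨c, hc⟩ := exists_center hx
  have hcg (g : Γ) (z : nearOrbit φ x ε) :
      (c ⟨sphereMap (φ g) z, sphereMap_mem_nearOrbit g z.2⟩).1 = sphereMap (φ g) (c z).1 := by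
    obtain ⟨h, hh⟩ := (c ⟨sphereMap (φ g) z, sphereMap_mem_nearOrbit g z.2⟩).2
    obtain ⟨k, hk⟩ := (c z).2
    have h₁ := hc ⟨sphereMap (φ g) z, sphereMap_mem_nearOrbit g z.2⟩
    have h₂ := hc z
    rw [← hh] at h₁ ⊢
    rw [← hk] at h₂ ⊢
    change _ = sphereMap (φ g) (sphereMap (φ k) x)
    rw [← ContinuousMap.comp_apply, ← sphereMap_mul, ← map_mul]
    refine eq_of_dist_lt hx h₁ ?_
    rw [map_mul, sphereMap_mul]
    exact (dist_sphereMap _ _ _).trans_lt h₂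
  have hd (z : nearOrbit φ x ε) : dist (z : E) (c z).1.1 ≤ 1 := ((hc z).trans_le hε').le
  have hn (z : Metric.sphere (0 : E) 1) : ‖(z : E)‖ = 1 := by simp
  let K (t : unitInterval) (z : nearOrbit φ x ε) : nearOrbit φ x ε :=
    ⟨⟨radialSegment t z (c z).1, by
      simpa using norm_radialSegment (hn _) (hn _) (hd z) t.2.1⟩, by
      obtain ⟨g, hg⟩ := (c z).2
      refine ⟨g, lt_of_le_of_lt ?_ (hc z)⟩
      change dist _ ((fun g ↦ sphereMap (φ g) x) g) ≤ _
      rw [hg]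
      exact dist_radialSegment_le (hn _) (hn _) (hd z) t.2.1 t.2.2⟩
  have hK : Continuous fun p : unitInterval × nearOrbit φ x ε ↦ K p.1 p.2 := by
    refine Continuous.subtype_mk (Continuous.subtype_mk ?_ _) _
    have hcc : Continuous fun p : unitInterval × nearOrbit φ x ε ↦ ((c p.2).1 : E) := by fun_prop
    refine Continuous.smul (Continuous.inv₀ (by fun_prop) fun p ↦ ?_) (by fun_prop)
    exact norm_ne_zero_iff.2 (segment_ne_zero (hn _) (hn _) (hd p.2) p.1.2.1)
  refine ⟨c, ⟨fun d ↦ ⟨d.1, ?_⟩, by fun_prop⟩, ⟨⟨fun p ↦ K p.1 p.2, hK⟩, fun z ↦ ?_, fun z ↦ ?_⟩,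
    fun _ ↦ rfl, fun g t z ↦ Subtype.ext ?_⟩
  · obtain ⟨_, g, rfl⟩ := d
    exact mem_nearOrbit hε g
  · refine Subtype.ext (Subtype.ext ?_)
    simp [K, radialSegment]
  · refine Subtype.ext (Subtype.ext ?_)
    simp [K, radialSegment]
  · change radialSegment _ _ _ = φ g (radialSegment _ _ _)
    rw [map_radialSegment, hcg]
    rfl

end

end Sphere

section SphereQuotient

variable {E : Type} [NormedAddCommGroup E] [InnerProductSpace ℝ E] {Γ : Type} [Group Γ]
  {φ : Γ →* (E ≃ₗᵢ[ℝ] E)}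

section

variable {Y : Type} [TopologicalSpace Y] {π : C(Metric.sphere (0 : E) 1, Y)}
  (hπ : IsOpenQuotientMap π) (horb : ∀ x x', π x = π x' ↔ ∃ g, sphereMap (φ g) x = x')
  {x : Metric.sphere (0 : E) 1} {ε : ℝ} (hx : IsSeparated φ x ε) (hε : 0 < ε) (hε' : ε ≤ 1)

lemma isOpen_nearOrbit (x : Metric.sphere (0 : E) 1) (ε : ℝ) : IsOpen (nearOrbit φ x ε) := by
  simp only [nearOrbit, Set.ofPred_exists]
  exact isOpen_iUnion fun g ↦ Metric.isOpen_ball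

include horb in
lemma preimage_image_nearOrbit (x : Metric.sphere (0 : E) 1) (ε : ℝ) :
    π ⁻¹' (π '' nearOrbit φ x ε) = nearOrbit φ x ε := by
  refine Set.Subset.antisymm ?_ (Set.subset_preimage_image _ _)
  rintro z ⟨y, hy, hyz⟩
  obtain ⟨g, rfl⟩ := (horb y z).1 hyz
  exact sphereMap_mem_nearOrbit g hy

include hx hε hε'

lemma boundsCycles_nearOrbit [Finite Γ] (q : ℕ) : BoundsCycles (nearOrbit φ x ε) q := by
  obtain ⟨r, s, H, -⟩ := exists_deformation hx hε hε'
  exact fun z hz hz' ↦ exists_mem_within_bd_eq r s H hz hz'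

lemma exists_bd_eq_norm_sub_norm [Fintype Γ] {y y' : Metric.sphere (0 : E) 1}
    (hy : y ∈ nearOrbit φ x ε) (hy' : y' ∈ nearOrbit φ x ε) :
    ∃ w ∈ within 1 (nearOrbit φ x ε), bd w =
      norm (fun g ↦ sphereMap (φ g)) 0 (single (point y) 1) -
        norm (fun g ↦ sphereMap (φ g)) 0 (single (point y') 1) := by
  obtain ⟨r, s, H, hs, -⟩ := exists_deformation hx hε hε'
  suffices h : ∀ y ∈ nearOrbit φ x ε, ∃ w ∈ within 1 (nearOrbit φ x ε), bd w =
      norm (fun g ↦ sphereMap (φ g)) 0 (single (point y) 1) -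
        norm (fun g ↦ sphereMap (φ g)) 0 (single (point x) 1) by
    obtain ⟨w, hw, hw'⟩ := h y hy
    obtain ⟨v, hv, hv'⟩ := h y' hy'
    exact ⟨w - v, sub_mem hw hv, by rw [map_sub, hw', hv']; abel⟩
  intro y hy
  obtain ⟨w, hw⟩ := IsCycle.exists_bd_eq_of_homotopy H
    (z := single (point (⟨y, hy⟩ : nearOrbit φ x ε)) 1) trivial
  obtain ⟨g, hg⟩ := (r ⟨y, hy⟩).2
  let i : C(nearOrbit φ x ε, Metric.sphere (0 : E) 1) := ⟨Subtype.val, continuous_subtype_val⟩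
  have h₁ : i.comp (point (⟨y, hy⟩ : nearOrbit φ x ε)) = point y := rfl
  have h₂ : i.comp ((s.comp r).comp (point (⟨y, hy⟩ : nearOrbit φ x ε))) =
      (sphereMap (φ g)).comp (point x) := ContinuousMap.ext fun _ ↦ (hs _).trans hg.symm
  refine ⟨norm _ 1 (push i w), norm_mem_within (fun g z hz ↦ sphereMap_mem_nearOrbit g hz)
    (push_subtype_mem_within w), ?_⟩
  rw [bd_norm, bd_push, hw, push_id, map_sub, map_sub, push_single, push_single, push_single, h₁,
    h₂, ← push_single, norm_push (fun g h ↦ by rw [map_mul, sphereMap_mul])]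

include hπ horb in
lemma boundsCycles_image_nearOrbit [Finite Γ] (q : ℕ) :
    BoundsCycles (π '' nearOrbit φ x ε) q := by
  obtain ⟨r, s, H, hs, hH⟩ := exists_deformation hx hε hε'
  let f (z : nearOrbit φ x ε) : π '' nearOrbit φ x ε := ⟨π z, z, z.2, rfl⟩
  have hf : IsOpenQuotientMap f := by
    refine ⟨?_, by fun_prop, ?_⟩
    · rintro ⟨_, z, hz, rfl⟩
      exact ⟨⟨z, hz⟩, rfl⟩
    · exact (hπ.isOpenMap.comp (isOpen_nearOrbit x ε).isOpenMap_subtype_val).subtype_mk _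
  have hff : IsOpenQuotientMap (Prod.map id f : unitInterval × _ → unitInterval × _) :=
    IsOpenQuotientMap.id.prodMap hf
  have hfac : Function.FactorsThrough (fun p ↦ f (H p)) (Prod.map id f) := by
    rintro ⟨t, z⟩ ⟨t', z'⟩ h
    obtain ⟨rfl, h⟩ := Prod.ext_iff.1 h
    obtain ⟨g, hg⟩ := (horb z.1 z'.1).1 (congrArg Subtype.val h)
    obtain rfl : ⟨_, sphereMap_mem_nearOrbit g z.2⟩ = z' := Subtype.ext hg
    refine Subtype.ext ?_
    change π (H (t, z)).1 = π (H (t, _)).1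
    rw [hH]
    exact (horb _ _).2 ⟨g, rfl⟩
  let K : C(unitInterval × (π '' nearOrbit φ x ε), π '' nearOrbit φ x ε) :=
    hff.isQuotientMap.lift (f := ⟨_, hff.continuous⟩)
      ⟨fun p ↦ f (H p), hf.continuous.comp H.continuous⟩ hfac
  have hK (t : unitInterval) (z : nearOrbit φ x ε) : K (t, f z) = f (H (t, z)) :=
    ContinuousMap.congr_fun (hff.isQuotientMap.lift_comp (f := ⟨_, hff.continuous⟩)
      ⟨fun p ↦ f (H p), hf.continuous.comp H.continuous⟩ hfac) (t, z)
  have hK₀ (y : π '' nearOrbit φ x ε) : K (0, y) = y := by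
    obtain ⟨z, rfl⟩ := hf.surjective y
    rw [hK, H.apply_zero]
    rfl
  let y₀ : π '' nearOrbit φ x ε := ⟨π x, x, ⟨1, by simpa [sphereMap] using hε⟩, rfl⟩
  have hK₁ (y : π '' nearOrbit φ x ε) : K (1, y) = y₀ := by
    obtain ⟨z, rfl⟩ := hf.surjective y
    rw [hK, H.apply_one]
    refine Subtype.ext ((horb _ _).2 ?_ : π x = _).symm
    obtain ⟨g, hg⟩ := (r z).2
    exact ⟨g, hg.trans (hs _).symm⟩
  exact fun z hz hz' ↦ exists_mem_within_bd_eq (D := Unit) (ContinuousMap.const _ ())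
    (ContinuousMap.const _ y₀) ⟨K, hK₀, hK₁⟩ hz hz'

end

lemma exists_isSeparated [Finite Γ] (x : Metric.sphere (0 : E) 1) :
    ∃ ε, 0 < ε ∧ ε ≤ 1 ∧ IsSeparated φ x ε := by
  let A := {p : Γ × Γ | sphereMap (φ p.1) x ≠ sphereMap (φ p.2) x}
  obtain ⟨δ, hδ, h⟩ : ∃ δ > 0, ∀ p ∈ A, δ ≤ dist (sphereMap (φ p.1) x) (sphereMap (φ p.2) x) := by
    rcases A.eq_empty_or_nonempty with hA | hA
    · exact ⟨1, one_pos, by simp [hA]⟩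
    · obtain ⟨p, hp, hp'⟩ := Set.exists_min_image A
        (fun p ↦ dist (sphereMap (φ p.1) x) (sphereMap (φ p.2) x)) (Set.toFinite _) hA
      exact ⟨_, dist_pos.2 hp, hp'⟩
  refine ⟨min 1 (δ / 2), by positivity, min_le_left _ _, fun g k hgk ↦ ?_⟩
  have := h (g, k) hgk
  have := min_le_right 1 (δ / 2)
  dsimp only at *
  linarith

lemma IsSeparated.mono {x : Metric.sphere (0 : E) 1} {ε δ : ℝ} (h : IsSeparated φ x ε)
    (hδ : δ ≤ ε) : IsSeparated φ x δ := fun g k hgk ↦ by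
  have := h g k hgk
  linarith

lemma nearOrbit_subset {x y : Metric.sphere (0 : E) 1} {ε ε' δ : ℝ}
    (h : (nearOrbit φ x ε ∩ nearOrbit φ y ε').Nonempty) :
    nearOrbit φ y δ ⊆ nearOrbit φ x (δ + ε' + ε) := by
  obtain ⟨z, ⟨g, hg⟩, k, hk⟩ := h
  rintro w ⟨l, hl⟩
  refine ⟨l * k⁻¹ * g, ?_⟩
  have hx : dist (sphereMap (φ (l * k⁻¹)) z) (sphereMap (φ (l * k⁻¹ * g)) x) < ε := by
    rwa [map_mul _ (l * k⁻¹), sphereMap_mul, ContinuousMap.comp_apply, dist_sphereMap]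
  have hy : dist (sphereMap (φ (l * k⁻¹)) z) (sphereMap (φ l) y) < ε' := by
    have : sphereMap (φ l) y = sphereMap (φ (l * k⁻¹)) (sphereMap (φ k) y) := by
      rw [← ContinuousMap.comp_apply, ← sphereMap_mul, ← map_mul, inv_mul_cancel_right]
    rwa [this, dist_sphereMap]
  have h₁ := dist_triangle w (sphereMap (φ (l * k⁻¹)) z) (sphereMap (φ (l * k⁻¹ * g)) x)
  have h₂ := dist_triangle_right w (sphereMap (φ (l * k⁻¹)) z) (sphereMap (φ l) y)
  linarith

/-- The quotient of a sphere by a finite group of linear isometries which act trivially on rational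
homology has the rational homology of the sphere. -/
theorem nonempty_singularHomologyQ_iso_of_sphere [FiniteDimensional ℝ E] [Fintype Γ] {Y : Type}
    [TopologicalSpace Y] {π : C(Metric.sphere (0 : E) 1, Y)} (hπ : IsOpenQuotientMap π)
    (horb : ∀ x x', π x = π x' ↔ ∃ g, sphereMap (φ g) x = x') (p : ℕ)
    (htriv : ∀ g, ∀ z : Chain p (Metric.sphere (0 : E) 1), IsCycle z →
      ∃ v, bd v = push (sphereMap (φ g)) z - z) :
    Nonempty (singularHomologyQ (TopCat.of Y) p ≅
      singularHomologyQ (TopCat.of (Metric.sphere (0 : E) 1)) p) := by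
  have : ProperSpace E := FiniteDimensional.proper_real E
  choose ε hε hε₁ hε' using exists_isSeparated (φ := φ)
  let r (x : Metric.sphere (0 : E) 1) : ℝ := ε x / (2 * p + 3)
  have hr x : 0 < r x := div_pos (hε x) (by positivity)
  obtain ⟨s, hs⟩ := isCompact_univ.elim_finite_subcover (fun x ↦ nearOrbit φ x (r x))
    (fun x ↦ isOpen_nearOrbit _ _)
    (fun x _ ↦ Set.mem_iUnion.2 ⟨x, 1, by simpa [sphereMap] using hr x⟩)
  let 𝒰 : GradedCover Y :=
    { ι := s
      finite := inferInstance
      radius x := r x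
      stage q x := π '' nearOrbit φ x.1 ((2 * q + 1) * r x)
      isOpen_stage x := hπ.isOpenMap _ (isOpen_nearOrbit _ _)
      iUnion_stage := by
        refine Set.eq_univ_of_forall fun y ↦ ?_
        obtain ⟨z, rfl⟩ := hπ.surjective y
        obtain ⟨x, hx, hz⟩ := Set.mem_iUnion₂.1 (hs (Set.mem_univ z))
        exact Set.mem_iUnion.2 ⟨⟨x, hx⟩, z, by simpa using hz, rfl⟩
      stage_subset q x y hxy := by
        rintro ⟨_, ⟨z, hz, rfl⟩, hz'⟩
        rw [← Set.mem_preimage, preimage_image_nearOrbit horb] at hz'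
        refine Set.image_mono ((nearOrbit_subset ⟨z, hz, hz'⟩).trans ?_)
        rintro w ⟨g, hg⟩
        refine ⟨g, hg.trans_le ?_⟩
        push_cast
        have : 0 ≤ (q : ℝ) := q.cast_nonneg
        nlinarith }
  have hle {q : ℕ} (hq : q ≤ p + 1) (x : Metric.sphere (0 : E) 1) : (2 * q + 1) * r x ≤ ε x := by
    have hq' : (q : ℝ) ≤ p + 1 := by exact_mod_cast hq
    have : (2 * p + 3) * r x = ε x := mul_div_cancel₀ _ (by positivity)
    have := hr x
    nlinarith
  have hpos (q : ℕ) (x : Metric.sphere (0 : E) 1) : 0 < (2 * q + 1) * r x :=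
    mul_pos (by positivity) (hr x)
  refine nonempty_singularHomologyQ_iso_of_gradedCover (act := fun g ↦ sphereMap (φ g)) p 𝒰
    (fun g h ↦ by rw [map_mul, sphereMap_mul])
    (fun g ↦ ContinuousMap.ext fun x ↦ ((horb x _).2 ⟨g, rfl⟩).symm) hπ.surjective
    (fun x x' ↦ (horb x x').1) (fun q hq x ↦ ?_) (fun q hq x ↦ ?_) (fun q hq x ↦ ?_) htriv
  · exact boundsCycles_image_nearOrbit hπ horb ((hε' x).mono (hle hq x)) (hpos q x)
      ((hle hq x).trans (hε₁ x))
  · change ∀ r, BoundsCycles (π ⁻¹' (π '' nearOrbit _ _ _)) r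
    rw [preimage_image_nearOrbit horb]
    exact boundsCycles_nearOrbit ((hε' x).mono (hle hq x)) (hpos q x) ((hle hq x).trans (hε₁ x))
  · change ∀ y ∈ π ⁻¹' (π '' nearOrbit _ _ _), ∀ y' ∈ π ⁻¹' (π '' nearOrbit _ _ _),
      ∃ w ∈ within 1 (π ⁻¹' (π '' nearOrbit _ _ _)), _
    rw [preimage_image_nearOrbit horb]
    exact fun y hy y' hy' ↦ exists_bd_eq_norm_sub_norm ((hε' x).mono (hle hq x)) (hpos q x)
      ((hle hq x).trans (hε₁ x)) hy hy'

end SphereQuotient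

section Reflections

variable {E : Type} [NormedAddCommGroup E] [InnerProductSpace ℝ E]

/-- The reflection in the hyperplane orthogonal to a vector. -/
def hyperplaneReflection (u : E) : E ≃ₗᵢ[ℝ] E := (Submodule.span ℝ {u})ᗮ.reflection

lemma hyperplaneReflection_apply (u x : E) :
    hyperplaneReflection u x = x - (2 : ℝ) • (inner ℝ u x / ‖u‖ ^ 2) • u := by
  rw [hyperplaneReflection, Submodule.reflection_orthogonal_apply,
    Submodule.reflection_singleton_apply, neg_sub]
  simp [two_smul]

lemma hyperplaneReflection_mul_self (u : E) :
    hyperplaneReflection u * hyperplaneReflection u = 1 :=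
  Submodule.reflection_mul_reflection _

lemma homotopic_sphereMap_hyperplaneReflection {u v : E} (hu : u ≠ 0) (hv : v ≠ 0) :
    (sphereMap (hyperplaneReflection u)).Homotopic (sphereMap (hyperplaneReflection v)) := by
  by_cases h : ∀ t : unitInterval, (1 - t : ℝ) • u + (t : ℝ) • v ≠ 0
  · refine ⟨⟨⟨fun p ↦ sphereMap (hyperplaneReflection ((1 - p.1 : ℝ) • u + (p.1 : ℝ) • v)) p.2,
      ?_⟩, fun x ↦ by simp, fun x ↦ by simp⟩⟩
    refine Continuous.subtype_mk ?_ _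
    simp only [hyperplaneReflection_apply]
    have h' (p : unitInterval × Metric.sphere (0 : E) 1) :
        ‖(1 - p.1 : ℝ) • u + (p.1 : ℝ) • v‖ ^ 2 ≠ 0 := pow_ne_zero 2 (norm_ne_zero_iff.2 (h p.1))
    fun_prop (disch := exact h')
  · push Not at h
    obtain ⟨t, ht⟩ := h
    have ht₀ : (t : ℝ) ≠ 0 := fun h ↦ hu (by simpa [h] using ht)
    have ht₁ : (1 - t : ℝ) ≠ 0 := fun h ↦ hv (by
      rw [h, zero_smul, zero_add] at ht
      exact (smul_eq_zero.1 ht).resolve_left ht₀)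
    have hspan : Submodule.span ℝ {u} = Submodule.span ℝ {v} := by
      rw [← Submodule.span_singleton_smul_eq (IsUnit.mk0 _ ht₁) u,
        ← Submodule.span_singleton_smul_eq (IsUnit.mk0 _ ht₀) v, eq_neg_of_add_eq_zero_left ht,
        ← Set.neg_singleton, Submodule.span_neg]
    have huv : hyperplaneReflection u = hyperplaneReflection v := by
      simp only [hyperplaneReflection, hspan]
    rw [huv]

variable [FiniteDimensional ℝ E]

lemma det_hyperplaneReflection {u : E} (hu : u ≠ 0) :
    LinearMap.det ((hyperplaneReflection u).toLinearEquiv : E →ₗ[ℝ] E) = -1 := by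
  have := (Submodule.span ℝ {u})ᗮ.det_reflection
  rw [Submodule.orthogonal_orthogonal, finrank_span_singleton hu, pow_one] at this
  exact this

lemma homotopic_sphereMap_of_list (l : List E) :
    let g := (l.map hyperplaneReflection).prod
    (LinearMap.det (g.toLinearEquiv : E →ₗ[ℝ] E) = 1 ∧
      (sphereMap g).Homotopic (ContinuousMap.id _)) ∨
    (LinearMap.det (g.toLinearEquiv : E →ₗ[ℝ] E) = -1 ∧
      ∃ v ≠ 0, (sphereMap g).Homotopic (sphereMap (hyperplaneReflection v))) := by
  induction l with
  | nil => exact Or.inl ⟨LinearMap.det_id, ContinuousMap.Homotopic.refl _⟩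
  | cons u l ih =>
    intro g
    set g' := (l.map hyperplaneReflection).prod
    have hg : g = hyperplaneReflection u * g' := by simp [g, g']
    have hdet : LinearMap.det (g.toLinearEquiv : E →ₗ[ℝ] E) =
        LinearMap.det ((hyperplaneReflection u).toLinearEquiv : E →ₗ[ℝ] E) *
          LinearMap.det (g'.toLinearEquiv : E →ₗ[ℝ] E) := by
      rw [hg, ← LinearMap.det_comp]
      rfl
    by_cases hu : u = 0
    · have : hyperplaneReflection u = 1 := by
        ext x
        simp [hyperplaneReflection_apply, hu]
      rw [hg, this, one_mul]
      exact ih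
    · rw [hdet, det_hyperplaneReflection hu, hg, sphereMap_mul]
      rcases ih with ⟨h, h'⟩ | ⟨h, v, hv, h'⟩
      · refine Or.inr ⟨by rw [h, mul_one], u, hu, ?_⟩
        exact (ContinuousMap.Homotopic.refl (sphereMap (hyperplaneReflection u))).comp h'
      · refine Or.inl ⟨by rw [h]; norm_num, ?_⟩
        have := (ContinuousMap.Homotopic.refl (sphereMap (hyperplaneReflection u))).comp
          (h'.trans (homotopic_sphereMap_hyperplaneReflection hv hu))
        rwa [← sphereMap_mul (hyperplaneReflection u) (hyperplaneReflection u),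
          hyperplaneReflection_mul_self] at this

lemma homotopic_sphereMap_id {g : E ≃ₗᵢ[ℝ] E}
    (hg : LinearMap.det (g.toLinearEquiv : E →ₗ[ℝ] E) = 1) :
    (sphereMap g).Homotopic (ContinuousMap.id _) := by
  obtain ⟨l, -, hl⟩ := g.reflections_generate_dim
  have hl' : g = (l.map hyperplaneReflection).prod := hl
  rcases homotopic_sphereMap_of_list l with ⟨-, h⟩ | ⟨h, -⟩
  · rwa [← hl'] at h
  · rw [← hl', hg] at h
    norm_num at h

end Reflections

end RatChain

/-- let `n ≥ 1` and let `G` be a finite group of orientation-preserving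
orthogonal linear transformations of `ℝⁿ` (a finite subgroup of `O(n)` all of whose elements
have determinant `1`).  Then the orbit space `S^{n-1}/G` is a rational homology sphere:
`H_p(S^{n-1}/G; ℚ) ≅ H_p(S^{n-1}; ℚ)` for every `p`. -/
theorem orbit_space_of_sphere_is_rational_homology_sphere
    (n : ℕ) (hn : 1 ≤ n)
    (G : Subgroup (EuclideanSpace ℝ (Fin n) ≃ₗᵢ[ℝ] EuclideanSpace ℝ (Fin n)))
    [Finite G]
    (hdet : ∀ g ∈ G,
      LinearMap.det (g.toLinearEquiv :
        EuclideanSpace ℝ (Fin n) →ₗ[ℝ] EuclideanSpace ℝ (Fin n)) = 1)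
    (p : ℕ) :
    Nonempty
      (singularHomologyQ (TopCat.of (Quotient (sphereOrbitSetoid n G))) p ≅
        singularHomologyQ
          (TopCat.of (Metric.sphere (0 : EuclideanSpace ℝ (Fin n)) 1)) p) := by
  have := Fintype.ofFinite G
  let π : C(Metric.sphere (0 : EuclideanSpace ℝ (Fin n)) 1, Quotient (sphereOrbitSetoid n G)) :=
    ⟨Quotient.mk _, continuous_quotient_mk'⟩
  have horb (x x') : π x = π x' ↔ ∃ g : G, RatChain.sphereMap (G.subtype g) x = x' := by
    refine Quotient.eq.trans ⟨fun ⟨g, hg, h⟩ ↦ ⟨⟨g, hg⟩, Subtype.ext h⟩, fun ⟨g, h⟩ ↦ ?_⟩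
    exact ⟨g, g.2, congrArg Subtype.val h⟩
  have hπ : IsOpenQuotientMap π := by
    refine ⟨Quotient.mk_surjective, π.continuous, fun U hU ↦ ?_⟩
    have h : π ⁻¹' (π '' U) = ⋃ g : G, RatChain.sphereMap (G.subtype g) ⁻¹' U := by
      ext x
      simp only [Set.mem_preimage, Set.mem_image, Set.mem_iUnion]
      constructor
      · rintro ⟨y, hy, h⟩
        obtain ⟨g, rfl⟩ := (horb x y).1 h.symm
        exact ⟨g, hy⟩
      · rintro ⟨g, hg⟩
        exact ⟨_, hg, ((horb _ _).2 ⟨g, rfl⟩).symm⟩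
    refine isQuotientMap_quotient_mk'.isOpen_preimage.1 (?_ : IsOpen (π ⁻¹' (π '' U)))
    rw [h]
    exact isOpen_iUnion fun g ↦ hU.preimage (RatChain.sphereMap _).continuous
  refine RatChain.nonempty_singularHomologyQ_iso_of_sphere hπ horb p fun g z hz ↦ ?_
  obtain ⟨H⟩ := RatChain.homotopic_sphereMap_id (hdet g g.2)
  obtain ⟨w, hw⟩ := hz.exists_bd_eq_of_homotopy H
  exact ⟨w, by rw [hw, RatChain.push_id]; rfl⟩
end
end
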